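/- arXiv:0706.0040 — 2 statements merged into one kernel-verified Lean document; each statement's English description precedes it below -/
import Mathlib

section
/- Let k be a field, (H, c) a cocommutative braided Hopf algebra over k, and (A, s) a left H-module algebra with action ρ. For n ≥ 1 regard H^{⊗(n+1)} as a left H-module via h·(h₁⊗h₂⊗⋯⊗h_{n+1}) = (hh₁)⊗h₂⊗⋯⊗h_{n+1}. Then the map ι_n sending f : H^{⊗(n+1)} → A to ι_n(f) : H^{⊗n} → A, ι_n(f)(x) := f(1⊗x), restricts to a bijection from Reg^s_H(H^{n+1}, A) onto Reg^s(H^n, A), and ι_n(f*g) = ι_n(f)*ι_n(g); hence ι_n is an isomorphism of abelian groups Reg^s_H(H^{n+1}, A) ≅ Reg^s(H^n, A). -/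
open TensorProduct LinearMap

noncomputable section

set_option maxHeartbeats 1000000

/-- The data of a braided Hopf algebra structure `(H, c, S)` (on the given algebra and
coalgebra structures of `H`) together with a left `H`-braided module algebra structure
`(A, s, ρ)`. -/
structure ModAlgData (k H A : Type*) [Field k] [Ring H] [Algebra k H] [Coalgebra k H]
    [Ring A] [Algebra k A] where
  /-- the braid of `H` -/
  c : H ⊗[k] H →ₗ[k] H ⊗[k] H
  /-- the antipode of `H` -/
  antipode : H →ₗ[k] H
  /-- the left transposition of `H` on `A` -/
  s : H ⊗[k] A →ₗ[k] A ⊗[k] H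
  /-- the action of `H` on `A` -/
  ρ : H ⊗[k] A →ₗ[k] A
  c_bij : Function.Bijective c
  s_bij : Function.Bijective s
  /-- `Δ(1) = 1⊗1` -/
  comul_one : Coalgebra.comul (R := k) (1 : H) = (1 : H) ⊗ₜ[k] (1 : H)
  /-- `ε(1) = 1` -/
  counit_one : Coalgebra.counit (R := k) (1 : H) = 1
  /-- `ε(hl) = ε(h)ε(l)` -/
  counit_mul : ∀ x y : H, Coalgebra.counit (R := k) (x * y) =
    Coalgebra.counit (R := k) x * Coalgebra.counit (R := k) y
  /-- `c(1⊗h) = h⊗1` -/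
  c_one_left : ∀ h : H, c ((1 : H) ⊗ₜ[k] h) = h ⊗ₜ[k] (1 : H)
  /-- `c(h⊗1) = 1⊗h` -/
  c_one_right : ∀ h : H, c (h ⊗ₜ[k] (1 : H)) = (1 : H) ⊗ₜ[k] h
  /-- `c∘(μ⊗H) = (H⊗μ)∘(c⊗H)∘(H⊗c)` -/
  c_mul_left : c ∘ₗ rTensor H (LinearMap.mul' k H) =
    lTensor H (LinearMap.mul' k H) ∘ₗ (TensorProduct.assoc k H H H).toLinearMap
      ∘ₗ rTensor H c ∘ₗ (TensorProduct.assoc k H H H).symm.toLinearMap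
      ∘ₗ lTensor H c ∘ₗ (TensorProduct.assoc k H H H).toLinearMap
  /-- `c∘(H⊗μ) = (μ⊗H)∘(H⊗c)∘(c⊗H)` -/
  c_mul_right : c ∘ₗ lTensor H (LinearMap.mul' k H) =
    rTensor H (LinearMap.mul' k H) ∘ₗ (TensorProduct.assoc k H H H).symm.toLinearMap
      ∘ₗ lTensor H c ∘ₗ (TensorProduct.assoc k H H H).toLinearMap
      ∘ₗ rTensor H c ∘ₗ (TensorProduct.assoc k H H H).symm.toLinearMap
  /-- `(H⊗Δ)∘c = (c⊗H)∘(H⊗c)∘(Δ⊗H)` -/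
  c_comul_left : lTensor H (Coalgebra.comul (R := k)) ∘ₗ c =
    (TensorProduct.assoc k H H H).toLinearMap ∘ₗ rTensor H c
      ∘ₗ (TensorProduct.assoc k H H H).symm.toLinearMap ∘ₗ lTensor H c
      ∘ₗ (TensorProduct.assoc k H H H).toLinearMap ∘ₗ rTensor H (Coalgebra.comul (R := k))
  /-- `(Δ⊗H)∘c = (H⊗c)∘(c⊗H)∘(H⊗Δ)` -/
  c_comul_right : rTensor H (Coalgebra.comul (R := k)) ∘ₗ c =
    (TensorProduct.assoc k H H H).symm.toLinearMap ∘ₗ lTensor H c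
      ∘ₗ (TensorProduct.assoc k H H H).toLinearMap ∘ₗ rTensor H c
      ∘ₗ (TensorProduct.assoc k H H H).symm.toLinearMap ∘ₗ lTensor H (Coalgebra.comul (R := k))
  /-- `(H⊗ε)∘c = ε⊗H` -/
  c_counit_left : (TensorProduct.rid k H).toLinearMap
      ∘ₗ lTensor H (Coalgebra.counit (R := k)) ∘ₗ c =
    (TensorProduct.lid k H).toLinearMap ∘ₗ rTensor H (Coalgebra.counit (R := k))
  /-- `(ε⊗H)∘c = H⊗ε` -/
  c_counit_right : (TensorProduct.lid k H).toLinearMap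
      ∘ₗ rTensor H (Coalgebra.counit (R := k)) ∘ₗ c =
    (TensorProduct.rid k H).toLinearMap ∘ₗ lTensor H (Coalgebra.counit (R := k))
  /-- `Δ∘μ = (μ⊗μ)∘(H⊗c⊗H)∘(Δ⊗Δ)` -/
  comul_mul : Coalgebra.comul (R := k) ∘ₗ LinearMap.mul' k H =
    TensorProduct.map (LinearMap.mul' k H) (LinearMap.mul' k H)
      ∘ₗ (TensorProduct.assoc k H H (H ⊗[k] H)).symm.toLinearMap
      ∘ₗ lTensor H ((TensorProduct.assoc k H H H).toLinearMap ∘ₗ rTensor H c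
          ∘ₗ (TensorProduct.assoc k H H H).symm.toLinearMap)
      ∘ₗ (TensorProduct.assoc k H H (H ⊗[k] H)).toLinearMap
      ∘ₗ TensorProduct.map (Coalgebra.comul (R := k)) (Coalgebra.comul (R := k))
  /-- `μ∘(S⊗H)∘Δ = η∘ε` -/
  antipode_left : LinearMap.mul' k H ∘ₗ rTensor H antipode ∘ₗ Coalgebra.comul (R := k) =
    Algebra.linearMap k H ∘ₗ Coalgebra.counit (R := k)
  /-- `μ∘(H⊗S)∘Δ = η∘ε` -/
  antipode_right : LinearMap.mul' k H ∘ₗ lTensor H antipode ∘ₗ Coalgebra.comul (R := k) =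
    Algebra.linearMap k H ∘ₗ Coalgebra.counit (R := k)
  /-- `s(1⊗a) = a⊗1` -/
  s_one_left : ∀ a : A, s ((1 : H) ⊗ₜ[k] a) = a ⊗ₜ[k] (1 : H)
  /-- `s(h⊗1) = 1⊗h` -/
  s_one_right : ∀ h : H, s (h ⊗ₜ[k] (1 : A)) = (1 : A) ⊗ₜ[k] h
  /-- `s∘(μ⊗A) = (A⊗μ)∘(s⊗H)∘(H⊗s)` -/
  s_mul_H : s ∘ₗ rTensor A (LinearMap.mul' k H) =
    lTensor A (LinearMap.mul' k H) ∘ₗ (TensorProduct.assoc k A H H).toLinearMap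
      ∘ₗ rTensor H s ∘ₗ (TensorProduct.assoc k H A H).symm.toLinearMap
      ∘ₗ lTensor H s ∘ₗ (TensorProduct.assoc k H H A).toLinearMap
  /-- `(A⊗ε)∘s = ε⊗A` -/
  s_counit : (TensorProduct.rid k A).toLinearMap
      ∘ₗ lTensor A (Coalgebra.counit (R := k)) ∘ₗ s =
    (TensorProduct.lid k A).toLinearMap ∘ₗ rTensor A (Coalgebra.counit (R := k))
  /-- `(A⊗Δ)∘s = (s⊗H)∘(H⊗s)∘(Δ⊗A)` -/
  s_comul : lTensor A (Coalgebra.comul (R := k)) ∘ₗ s =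
    (TensorProduct.assoc k A H H).toLinearMap ∘ₗ rTensor H s
      ∘ₗ (TensorProduct.assoc k H A H).symm.toLinearMap ∘ₗ lTensor H s
      ∘ₗ (TensorProduct.assoc k H H A).toLinearMap ∘ₗ rTensor A (Coalgebra.comul (R := k))
  /-- `(s⊗H)∘(H⊗s)∘(c⊗A) = (A⊗c)∘(s⊗H)∘(H⊗s)` -/
  s_braid : (TensorProduct.assoc k A H H).toLinearMap ∘ₗ rTensor H s
      ∘ₗ (TensorProduct.assoc k H A H).symm.toLinearMap ∘ₗ lTensor H s
      ∘ₗ (TensorProduct.assoc k H H A).toLinearMap ∘ₗ rTensor A c =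
    lTensor A c ∘ₗ (TensorProduct.assoc k A H H).toLinearMap ∘ₗ rTensor H s
      ∘ₗ (TensorProduct.assoc k H A H).symm.toLinearMap ∘ₗ lTensor H s
      ∘ₗ (TensorProduct.assoc k H H A).toLinearMap
  /-- `s∘(H⊗μ_A) = (μ_A⊗H)∘(A⊗s)∘(s⊗A)` -/
  s_mul_A : s ∘ₗ lTensor H (LinearMap.mul' k A) =
    rTensor H (LinearMap.mul' k A) ∘ₗ (TensorProduct.assoc k A A H).symm.toLinearMap
      ∘ₗ lTensor A s ∘ₗ (TensorProduct.assoc k A H A).toLinearMap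
      ∘ₗ rTensor A s ∘ₗ (TensorProduct.assoc k H A A).symm.toLinearMap
  /-- `ρ(1⊗a) = a` -/
  ρ_one : ∀ a : A, ρ ((1 : H) ⊗ₜ[k] a) = a
  /-- `ρ∘(μ⊗A) = ρ∘(H⊗ρ)` -/
  ρ_mul : ρ ∘ₗ rTensor A (LinearMap.mul' k H) =
    ρ ∘ₗ lTensor H ρ ∘ₗ (TensorProduct.assoc k H H A).toLinearMap
  /-- `s∘(H⊗ρ) = (ρ⊗H)∘(H⊗s)∘(c⊗A)` -/
  s_ρ : s ∘ₗ lTensor H ρ =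
    rTensor H ρ ∘ₗ (TensorProduct.assoc k H A H).symm.toLinearMap ∘ₗ lTensor H s
      ∘ₗ (TensorProduct.assoc k H H A).toLinearMap ∘ₗ rTensor A c
      ∘ₗ (TensorProduct.assoc k H H A).symm.toLinearMap
  /-- `ρ∘(H⊗μ_A) = μ_A∘(ρ⊗ρ)∘(H⊗s⊗A)∘(Δ⊗A⊗A)` -/
  ρ_mul_A : ρ ∘ₗ lTensor H (LinearMap.mul' k A) =
    LinearMap.mul' k A ∘ₗ TensorProduct.map ρ ρ
      ∘ₗ (TensorProduct.assoc k H A (H ⊗[k] A)).symm.toLinearMap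
      ∘ₗ lTensor H ((TensorProduct.assoc k A H A).toLinearMap ∘ₗ rTensor A s
          ∘ₗ (TensorProduct.assoc k H A A).symm.toLinearMap)
      ∘ₗ (TensorProduct.assoc k H H (A ⊗[k] A)).toLinearMap
      ∘ₗ rTensor (A ⊗[k] A) (Coalgebra.comul (R := k))
  /-- `ρ(h⊗1) = ε(h)1` -/
  ρ_unit : ∀ h : H, ρ (h ⊗ₜ[k] (1 : A)) = Coalgebra.counit (R := k) h • (1 : A)

variable {k H A : Type*} [Field k] [Ring H] [Algebra k H] [Coalgebra k H]
  [Ring A] [Algebra k A]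

/-- `(H, c)` is cocommutative: `c∘c = id` and `c∘Δ = Δ`. -/
def ModAlgData.Cocomm (D : ModAlgData k H A) : Prop :=
  D.c ∘ₗ D.c = LinearMap.id ∧
    D.c ∘ₗ Coalgebra.comul (R := k) = Coalgebra.comul (R := k)

/-- The convolution product on `Hom_k(H, A)`. -/
def conv1 (f g : H →ₗ[k] A) : H →ₗ[k] A :=
  LinearMap.mul' k A ∘ₗ TensorProduct.map f g ∘ₗ Coalgebra.comul (R := k)

/-- The convolution unit `η_A∘ε` on `Hom_k(H, A)`. -/
def unit1 : H →ₗ[k] A :=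
  Algebra.linearMap k A ∘ₗ Coalgebra.counit (R := k)

/-- The map `χ := (ρ⊗H)∘(H⊗s)∘(Δ⊗A) : H⊗A → A⊗H`. -/
def ModAlgData.χ (D : ModAlgData k H A) : H ⊗[k] A →ₗ[k] A ⊗[k] H :=
  rTensor H D.ρ ∘ₗ (TensorProduct.assoc k H A H).symm.toLinearMap ∘ₗ lTensor H D.s
    ∘ₗ (TensorProduct.assoc k H H A).toLinearMap
    ∘ₗ rTensor A (Coalgebra.comul (R := k))

/-- The `(n+1)`-fold tensor power `H^{⊗(n+1)}` as a bundled `k`-module (left-nested: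
`TPowM k H (n+1) = H ⊗ TPowM k H n`). -/
noncomputable def TPowM (k H : Type) [Field k] [AddCommGroup H] [Module k H] :
    ℕ → ModuleCat k
  | 0 => ModuleCat.of k H
  | n + 1 => ModuleCat.of k (H ⊗[k] (TPowM k H n : Type))

/-- The `(n+1)`-fold tensor power `H^{⊗(n+1)}`. -/
noncomputable abbrev TPow (k H : Type) [Field k] [AddCommGroup H] [Module k H] (n : ℕ) :
    Type := TPowM k H n

variable {k' H' A' : Type} [Field k'] [Ring H'] [Algebra k' H'] [Coalgebra k' H']
  [Ring A'] [Algebra k' A']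

/-- `sⁿ : H^{⊗(n+1)}⊗A → A⊗H^{⊗(n+1)}`. -/
noncomputable def sPow (D : ModAlgData k' H' A') :
    ∀ n, TPow k' H' n ⊗[k'] A' →ₗ[k'] A' ⊗[k'] TPow k' H' n
  | 0 => D.s
  | n + 1 =>
    (TensorProduct.assoc k' A' H' (TPow k' H' n)).toLinearMap
      ∘ₗ rTensor (TPow k' H' n) D.s
      ∘ₗ (TensorProduct.assoc k' H' A' (TPow k' H' n)).symm.toLinearMap
      ∘ₗ lTensor H' (sPow D n)
      ∘ₗ (TensorProduct.assoc k' H' (TPow k' H' n) A').toLinearMap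

/-- `c¹_{n+1} : H⊗H^{⊗(n+1)} → H^{⊗(n+1)}⊗H`. -/
noncomputable def cPow (D : ModAlgData k' H' A') :
    ∀ n, H' ⊗[k'] TPow k' H' n →ₗ[k'] TPow k' H' n ⊗[k'] H'
  | 0 => D.c
  | n + 1 =>
    (TensorProduct.assoc k' H' (TPow k' H' n) H').symm.toLinearMap
      ∘ₗ lTensor H' (cPow D n)
      ∘ₗ (TensorProduct.assoc k' H' H' (TPow k' H' n)).toLinearMap
      ∘ₗ rTensor (TPow k' H' n) D.c
      ∘ₗ (TensorProduct.assoc k' H' H' (TPow k' H' n)).symm.toLinearMap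

/-- The comultiplication `Δ_{H^{n+1}} : H^{⊗(n+1)} → H^{⊗(n+1)}⊗H^{⊗(n+1)}` of the
braided tensor power coalgebra. -/
noncomputable def comulPow (D : ModAlgData k' H' A') :
    ∀ n, TPow k' H' n →ₗ[k'] TPow k' H' n ⊗[k'] TPow k' H' n
  | 0 => (Coalgebra.comul : H' →ₗ[k'] H' ⊗[k'] H')
  | n + 1 =>
    (TensorProduct.assoc k' H' (TPow k' H' n) (H' ⊗[k'] TPow k' H' n)).symm.toLinearMap
      ∘ₗ lTensor H' ((TensorProduct.assoc k' (TPow k' H' n) H' (TPow k' H' n)).toLinearMap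
          ∘ₗ rTensor (TPow k' H' n) (cPow D n)
          ∘ₗ (TensorProduct.assoc k' H' (TPow k' H' n) (TPow k' H' n)).symm.toLinearMap)
      ∘ₗ (TensorProduct.assoc k' H' H' (TPow k' H' n ⊗[k'] TPow k' H' n)).toLinearMap
      ∘ₗ TensorProduct.map (Coalgebra.comul (R := k')) (comulPow D n)

/-- The counit `ε^{⊗(n+1)} : H^{⊗(n+1)} → k`. -/
noncomputable def counitPow (k H : Type) [Field k] [Ring H] [Algebra k H] [Coalgebra k H] :
    ∀ n, TPow k H n →ₗ[k] k
  | 0 => (Coalgebra.counit : H →ₗ[k] k)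
  | n + 1 => LinearMap.mul' k k
      ∘ₗ TensorProduct.map (Coalgebra.counit (R := k)) (counitPow k H n)

/-- The left `H`-action on `H^{⊗(n+1)}`, `h·(h₁⊗⋯⊗h_{n+1}) = (hh₁)⊗h₂⊗⋯⊗h_{n+1}`. -/
noncomputable def actPow (k H : Type) [Field k] [Ring H] [Algebra k H] [Coalgebra k H] :
    ∀ n, H ⊗[k] TPow k H n →ₗ[k] TPow k H n
  | 0 => LinearMap.mul' k H
  | n + 1 => rTensor (TPow k H n) (LinearMap.mul' k H)
      ∘ₗ (TensorProduct.assoc k H H (TPow k H n)).symm.toLinearMap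

/-- The convolution product on `Hom_k(H^{⊗(n+1)}, A)`. -/
noncomputable def convPow (D : ModAlgData k' H' A') (n : ℕ)
    (f g : TPow k' H' n →ₗ[k'] A') : TPow k' H' n →ₗ[k'] A' :=
  LinearMap.mul' k' A' ∘ₗ TensorProduct.map f g ∘ₗ comulPow D n

/-- The convolution unit on `Hom_k(H^{⊗(n+1)}, A)`. -/
noncomputable def unitPow (k H A : Type) [Field k] [Ring H] [Algebra k H] [Coalgebra k H]
    [Ring A] [Algebra k A] (n : ℕ) : TPow k H n →ₗ[k] A :=
  Algebra.linearMap k A ∘ₗ counitPow k H n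

/-- `f : H^{⊗(n+1)} → A` is compatible with `s`. -/
def CompatPow (D : ModAlgData k' H' A') (n : ℕ) (f : TPow k' H' n →ₗ[k'] A') : Prop :=
  D.s ∘ₗ lTensor H' f = rTensor H' f ∘ₗ cPow D n

/-- `f : H^{⊗(n+1)} → A` is `s`-central. -/
def CentralPow (D : ModAlgData k' H' A') (n : ℕ) (f : TPow k' H' n →ₗ[k'] A') : Prop :=
  LinearMap.mul' k' A' ∘ₗ lTensor A' f ∘ₗ sPow D n = LinearMap.mul' k' A' ∘ₗ rTensor A' f

/-- `Reg^s(H^{n+1}, A)`: compatible with `s`, `s`-central and convolution invertible. -/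
def RegS (D : ModAlgData k' H' A') (n : ℕ) : Set (TPow k' H' n →ₗ[k'] A') :=
  {f | CompatPow D n f ∧ CentralPow D n f ∧
    ∃ g, convPow D n f g = unitPow k' H' A' n ∧ convPow D n g f = unitPow k' H' A' n}

/-- `f : H^{⊗(n+1)} → A` is `H`-linear for the action on the first tensor factor. -/
def HLinearPow (D : ModAlgData k' H' A') (n : ℕ) (f : TPow k' H' n →ₗ[k'] A') : Prop :=
  f ∘ₗ actPow k' H' n = D.ρ ∘ₗ lTensor H' f

/-- `Reg^s_H(H^{n+1}, A)`. -/
def RegSH (D : ModAlgData k' H' A') (n : ℕ) : Set (TPow k' H' n →ₗ[k'] A') :=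
  {f | f ∈ RegS D n ∧ HLinearPow D n f}

/-- The map `ι_n : Hom(H^{⊗(n+2)}, A) → Hom(H^{⊗(n+1)}, A)`, `ι_n(f)(x) = f(1⊗x)`. -/
noncomputable def iotaPow (n : ℕ) (f : TPow k' H' (n + 1) →ₗ[k'] A') :
    TPow k' H' n →ₗ[k'] A' :=
  f ∘ₗ TensorProduct.mk k' H' (TPow k' H' n) 1

section MonoidalAction

open CategoryTheory MonoidalCategory

variable {C : Type*} [Category C] [MonoidalCategory C]

/-- A cocommutative braided Hopf algebra `H` and an `H`-braided module algebra `A` in a monoidal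
category, without the transposition axioms that relate `s` to the coalgebra structure. -/
structure BraidedAction (H A : C) where
  m : H ⊗ H ⟶ H
  e : 𝟙_ C ⟶ H
  d : H ⟶ H ⊗ H
  u : H ⟶ 𝟙_ C
  S : H ⟶ H
  c : H ⊗ H ⟶ H ⊗ H
  mA : A ⊗ A ⟶ A
  eA : 𝟙_ C ⟶ A
  s : H ⊗ A ⟶ A ⊗ H
  r : H ⊗ A ⟶ A
  m_assoc : m ▷ H ≫ m = (α_ H H H).hom ≫ H ◁ m ≫ m
  e_m : e ▷ H ≫ m = (λ_ H).hom
  m_e : H ◁ e ≫ m = (ρ_ H).hom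
  d_coassoc : d ≫ d ▷ H ≫ (α_ H H H).hom = d ≫ H ◁ d
  d_u_left : d ≫ u ▷ H = (λ_ H).inv
  d_u_right : d ≫ H ◁ u = (ρ_ H).inv
  c_e_left : e ▷ H ≫ c = (λ_ H).hom ≫ (ρ_ H).inv ≫ H ◁ e
  c_m_left : m ▷ H ≫ c = (α_ H H H).hom ≫ H ◁ c ≫ (α_ H H H).inv ≫ c ▷ H ≫
    (α_ H H H).hom ≫ H ◁ m
  c_d_left : c ≫ H ◁ d = d ▷ H ≫ (α_ H H H).hom ≫ H ◁ c ≫ (α_ H H H).inv ≫ c ▷ H ≫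
    (α_ H H H).hom
  c_d_right : c ≫ d ▷ H = H ◁ d ≫ (α_ H H H).inv ≫ c ▷ H ≫ (α_ H H H).hom ≫ H ◁ c ≫
    (α_ H H H).inv
  c_u_left : c ≫ H ◁ u ≫ (ρ_ H).hom = u ▷ H ≫ (λ_ H).hom
  c_u_right : c ≫ u ▷ H ≫ (λ_ H).hom = H ◁ u ≫ (ρ_ H).hom
  m_d : m ≫ d = (d ⊗ₘ d) ≫ (α_ H H (H ⊗ H)).hom ≫
    H ◁ ((α_ H H H).inv ≫ c ▷ H ≫ (α_ H H H).hom) ≫ (α_ H H (H ⊗ H)).inv ≫ (m ⊗ₘ m)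
  S_left : d ≫ S ▷ H ≫ m = u ≫ e
  S_right : d ≫ H ◁ S ≫ m = u ≫ e
  c_c : c ≫ c = 𝟙 _
  d_c : d ≫ c = d
  mA_assoc : mA ▷ A ≫ mA = (α_ A A A).hom ≫ A ◁ mA ≫ mA
  eA_mA : eA ▷ A ≫ mA = (λ_ A).hom
  mA_eA : A ◁ eA ≫ mA = (ρ_ A).hom
  s_e : e ▷ A ≫ s = (λ_ A).hom ≫ (ρ_ A).inv ≫ A ◁ e
  s_eA : H ◁ eA ≫ s = (ρ_ H).hom ≫ (λ_ H).inv ≫ eA ▷ H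
  s_mA : H ◁ mA ≫ s = (α_ H A A).inv ≫ s ▷ A ≫ (α_ A H A).hom ≫ A ◁ s ≫ (α_ A A H).inv ≫
    mA ▷ H
  r_e : e ▷ A ≫ r = (λ_ A).hom
  r_m : m ▷ A ≫ r = (α_ H H A).hom ≫ H ◁ r ≫ r
  s_r : H ◁ r ≫ s = (α_ H H A).inv ≫ c ▷ A ≫ (α_ H H A).hom ≫ H ◁ s ≫ (α_ H A H).inv ≫ r ▷ H
  r_mA : H ◁ mA ≫ r = d ▷ (A ⊗ A) ≫ (α_ H H (A ⊗ A)).hom ≫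
    H ◁ ((α_ H A A).inv ≫ s ▷ A ≫ (α_ A H A).hom) ≫ (α_ H A (H ⊗ A)).inv ≫ (r ⊗ₘ r) ≫ mA
  r_eA : H ◁ eA ≫ r = (ρ_ H).hom ≫ u ≫ eA

namespace BraidedAction

variable {H A : C} (D : BraidedAction H A)

/-- Left multiplication along the comultiplication can be cancelled, because of the antipode. -/
lemma left_cancel {Y W : C} {f g : H ⊗ Y ⟶ H ⊗ W}
    (h : D.d ▷ Y ⊗≫ H ◁ f ⊗≫ D.m ▷ W = D.d ▷ Y ⊗≫ H ◁ g ⊗≫ D.m ▷ W) : f = g := by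
  have key : ∀ f : H ⊗ Y ⟶ H ⊗ W,
      D.d ▷ Y ⊗≫ H ◁ (D.d ▷ Y ⊗≫ H ◁ f ⊗≫ D.m ▷ W) ⊗≫ (D.S ▷ H ≫ D.m) ▷ W = f := by
    intro f
    refine .trans (by monoidal) (.trans congr(𝟙 _ ⊗≫ D.d ▷ Y ⊗≫ H ◁ D.d ▷ Y ⊗≫ (H ⊗ H) ◁ f ⊗≫
      $(whisker_exchange D.S D.m) ▷ W ⊗≫ D.m ▷ W ⊗≫ 𝟙 _) ?_)
    refine .trans (by monoidal) (.trans congr(𝟙 _ ⊗≫ D.d ▷ Y ⊗≫ H ◁ D.d ▷ Y ⊗≫ (H ⊗ H) ◁ f ⊗≫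
      D.S ▷ (H ⊗ H) ▷ W ⊗≫ $(D.m_assoc.symm) ▷ W ⊗≫ 𝟙 _) ?_)
    refine .trans (by monoidal) (.trans congr(𝟙 _ ⊗≫ $(D.d_coassoc.symm) ▷ Y ⊗≫ (H ⊗ H) ◁ f ⊗≫
      D.S ▷ (H ⊗ H) ▷ W ⊗≫ D.m ▷ H ▷ W ⊗≫ D.m ▷ W ⊗≫ 𝟙 _) ?_)
    refine .trans (by monoidal) (.trans congr(𝟙 _ ⊗≫ D.d ▷ Y ⊗≫ D.d ▷ H ▷ Y ⊗≫
      $(whisker_exchange (D.S ▷ H ≫ D.m) f) ⊗≫ D.m ▷ W ⊗≫ 𝟙 _) ?_)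
    refine .trans (by monoidal) (.trans congr(𝟙 _ ⊗≫ D.d ▷ Y ⊗≫ $(D.S_left) ▷ H ▷ Y ⊗≫ H ◁ f ⊗≫
      D.m ▷ W ⊗≫ 𝟙 _) ?_)
    refine .trans (by monoidal) (.trans congr(𝟙 _ ⊗≫ $(D.d_u_left) ▷ Y ⊗≫
      $((whisker_exchange D.e f).symm) ⊗≫ D.m ▷ W ⊗≫ 𝟙 _) ?_)
    refine .trans (by monoidal) (.trans congr(𝟙 _ ⊗≫ f ⊗≫ $(D.e_m) ▷ W ⊗≫ 𝟙 _) ?_)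
    monoidal
  rw [← key f, h, key g]

/-- Right multiplication along the comultiplication can be cancelled, because of the antipode. -/
lemma right_cancel {Y W : C} {f g : Y ⊗ H ⟶ W ⊗ H}
    (h : Y ◁ D.d ⊗≫ f ▷ H ⊗≫ W ◁ D.m = Y ◁ D.d ⊗≫ g ▷ H ⊗≫ W ◁ D.m) : f = g := by
  have key : ∀ f : Y ⊗ H ⟶ W ⊗ H,
      Y ◁ D.d ⊗≫ (Y ◁ D.d ⊗≫ f ▷ H ⊗≫ W ◁ D.m) ▷ H ⊗≫ W ◁ (H ◁ D.S ≫ D.m) = f := by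
    intro f
    refine .trans (by monoidal) (.trans congr(𝟙 _ ⊗≫ Y ◁ D.d ⊗≫ Y ◁ D.d ▷ H ⊗≫ f ▷ (H ⊗ H) ⊗≫
      W ◁ $((whisker_exchange D.m D.S).symm) ⊗≫ W ◁ D.m ⊗≫ 𝟙 _) ?_)
    refine .trans (by monoidal) (.trans congr(𝟙 _ ⊗≫ Y ◁ D.d ⊗≫ Y ◁ D.d ▷ H ⊗≫ f ▷ (H ⊗ H) ⊗≫
      W ◁ (H ⊗ H) ◁ D.S ⊗≫ W ◁ $(D.m_assoc) ⊗≫ 𝟙 _) ?_)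
    refine .trans (by monoidal) (.trans congr(𝟙 _ ⊗≫ Y ◁ $(D.d_coassoc) ⊗≫ f ▷ (H ⊗ H) ⊗≫
      W ◁ (H ⊗ H) ◁ D.S ⊗≫ W ◁ H ◁ D.m ⊗≫ W ◁ D.m ⊗≫ 𝟙 _) ?_)
    refine .trans (by monoidal) (.trans congr(𝟙 _ ⊗≫ Y ◁ D.d ⊗≫ Y ◁ H ◁ D.d ⊗≫
      $((whisker_exchange f (H ◁ D.S ≫ D.m)).symm) ⊗≫ W ◁ D.m ⊗≫ 𝟙 _) ?_)
    refine .trans (by monoidal) (.trans congr(𝟙 _ ⊗≫ Y ◁ D.d ⊗≫ Y ◁ H ◁ $(D.S_right) ⊗≫ f ▷ H ⊗≫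
      W ◁ D.m ⊗≫ 𝟙 _) ?_)
    refine .trans (by monoidal) (.trans congr(𝟙 _ ⊗≫ Y ◁ $(D.d_u_right) ⊗≫
      $(whisker_exchange f D.e) ⊗≫ W ◁ D.m ⊗≫ 𝟙 _) ?_)
    refine .trans (by monoidal) (.trans congr(𝟙 _ ⊗≫ f ⊗≫ W ◁ $(D.m_e) ⊗≫ 𝟙 _) ?_)
    monoidal
  rw [← key f, h, key g]

lemma m_d' : D.m ≫ D.d = D.d ▷ H ⊗≫ (H ⊗ H) ◁ D.d ⊗≫ H ◁ D.c ▷ H ⊗≫ D.m ▷ (H ⊗ H) ⊗≫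
    H ◁ D.m := by
  rw [D.m_d, MonoidalCategory.tensorHom_def, MonoidalCategory.tensorHom_def]
  monoidal

lemma r_mA' : H ◁ D.mA ≫ D.r = D.d ▷ (A ⊗ A) ⊗≫ H ◁ D.s ▷ A ⊗≫ D.r ▷ (H ⊗ A) ⊗≫ A ◁ D.r ⊗≫
    D.mA := by
  rw [D.r_mA, MonoidalCategory.tensorHom_def]
  monoidal

lemma c_m_c : D.c ▷ H ⊗≫ H ◁ D.m ⊗≫ D.c = 𝟙 _ ⊗≫ H ◁ D.c ⊗≫ D.m ▷ H := by
  refine .trans (by monoidal) (.trans congr(𝟙 _ ⊗≫ H ◁ $(D.c_c.symm) ⊗≫ D.c ▷ H ⊗≫ H ◁ D.m ⊗≫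
    D.c ⊗≫ 𝟙 _) ?_)
  refine .trans (by monoidal) (.trans congr(𝟙 _ ⊗≫ H ◁ D.c ⊗≫ $(D.c_m_left.symm) ⊗≫ D.c ⊗≫ 𝟙 _) ?_)
  refine .trans (by monoidal) (.trans congr(𝟙 _ ⊗≫ H ◁ D.c ⊗≫ D.m ▷ H ⊗≫ $(D.c_c) ⊗≫ 𝟙 _) ?_)
  monoidal

lemma c_d_c : D.c ⊗≫ D.d ▷ H ⊗≫ H ◁ D.c = H ◁ D.d ⊗≫ D.c ▷ H ⊗≫ 𝟙 _ := by
  refine .trans (by monoidal) (.trans congr(𝟙 _ ⊗≫ $(D.c_d_right) ⊗≫ H ◁ D.c ⊗≫ 𝟙 _) ?_)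
  refine .trans (by monoidal) (.trans congr(𝟙 _ ⊗≫ H ◁ D.d ⊗≫ D.c ▷ H ⊗≫ H ◁ $(D.c_c) ⊗≫ 𝟙 _) ?_)
  monoidal

/-- The operator that expresses how `U` enters the expansion of `Δ ∘ μ` moved past a strand. -/
def smear (U : H ⊗ H ⊗ H ⟶ H ⊗ H ⊗ H) : H ⊗ H ⊗ H ⟶ H ⊗ H ⊗ H :=
  D.d ▷ (H ⊗ H) ⊗≫ (H ⊗ H) ◁ D.d ▷ H ⊗≫ (H ⊗ H ⊗ H) ◁ D.c ⊗≫ H ◁ U ▷ H ⊗≫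
    D.c ▷ (H ⊗ H ⊗ H) ⊗≫ H ◁ D.m ▷ (H ⊗ H) ⊗≫ (H ⊗ H) ◁ D.m ⊗≫ 𝟙 _

lemma smear_injective : Function.Injective D.smear := by
  have key : ∀ U, D.smear U ⊗≫ D.c ▷ H ⊗≫ 𝟙 (H ⊗ H ⊗ H) = D.d ▷ (H ⊗ H) ⊗≫
      H ◁ (H ◁ D.d ▷ H ⊗≫ (H ⊗ H) ◁ D.c ⊗≫ (U ⊗≫ D.c ▷ H) ▷ H ⊗≫ (H ⊗ H) ◁ D.m ⊗≫
        𝟙 (H ⊗ H ⊗ H)) ⊗≫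
      D.m ▷ (H ⊗ H) := by
    intro U
    unfold smear
    refine .trans (by monoidal) (.trans congr(𝟙 _ ⊗≫ D.d ▷ (H ⊗ H) ⊗≫ (H ⊗ H) ◁ D.d ▷ H ⊗≫
      (H ⊗ H ⊗ H) ◁ D.c ⊗≫ H ◁ U ▷ H ⊗≫ D.c ▷ (H ⊗ H ⊗ H) ⊗≫ H ◁ D.m ▷ (H ⊗ H) ⊗≫
      $(whisker_exchange D.c D.m) ⊗≫ 𝟙 _) ?_)
    refine .trans (by monoidal) (.trans congr(𝟙 _ ⊗≫ D.d ▷ (H ⊗ H) ⊗≫ (H ⊗ H) ◁ D.d ▷ H ⊗≫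
      (H ⊗ H ⊗ H) ◁ D.c ⊗≫ H ◁ U ▷ H ⊗≫ $(D.c_m_c) ▷ (H ⊗ H) ⊗≫ (H ⊗ H) ◁ D.m ⊗≫ 𝟙 _) ?_)
    refine .trans (by monoidal) (.trans congr(𝟙 _ ⊗≫ D.d ▷ (H ⊗ H) ⊗≫ (H ⊗ H) ◁ D.d ▷ H ⊗≫
      (H ⊗ H ⊗ H) ◁ D.c ⊗≫ H ◁ U ▷ H ⊗≫ H ◁ D.c ▷ (H ⊗ H) ⊗≫
      $((whisker_exchange D.m (H ◁ D.m)).symm) ⊗≫ 𝟙 _) ?_)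
    monoidal
  have key' : ∀ V : H ⊗ H ⊗ H ⟶ (H ⊗ H) ⊗ H,
      H ◁ D.c ⊗≫ (H ◁ D.d ▷ H ⊗≫ (H ⊗ H) ◁ D.c ⊗≫ V ▷ H ⊗≫ (H ⊗ H) ◁ D.m) =
      𝟙 _ ⊗≫ (H ⊗ H) ◁ D.d ⊗≫ (𝟙 ((H ⊗ H) ⊗ H) ⊗≫ H ◁ D.c ⊗≫ V) ▷ H ⊗≫ (H ⊗ H) ◁ D.m := by
    intro V
    refine .trans (by monoidal) (.trans congr(𝟙 _ ⊗≫ H ◁ $(D.c_d_c) ⊗≫ V ▷ H ⊗≫ (H ⊗ H) ◁ D.m ⊗≫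
      𝟙 _) ?_)
    monoidal
  have key'' : ∀ U : H ⊗ H ⊗ H ⟶ H ⊗ H ⊗ H,
      H ◁ D.c ⊗≫ (𝟙 ((H ⊗ H) ⊗ H) ⊗≫ H ◁ D.c ⊗≫ (U ⊗≫ D.c ▷ H)) ⊗≫ D.c ▷ H ⊗≫
        𝟙 (H ⊗ H ⊗ H) = U := by
    intro U
    refine .trans (by monoidal) (.trans congr(𝟙 _ ⊗≫ H ◁ $(D.c_c) ⊗≫ U ⊗≫ $(D.c_c) ▷ H ⊗≫
      𝟙 (H ⊗ H ⊗ H) ⊗≫ 𝟙 _) ?_)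
    monoidal
  intro U V h
  have h1 := D.left_cancel ((key U).symm.trans ((congrArg (· ⊗≫ D.c ▷ H ⊗≫
    𝟙 (H ⊗ H ⊗ H)) h).trans (key V)))
  have h2 : (𝟙 _ ⊗≫ H ◁ D.c ⊗≫ (U ⊗≫ D.c ▷ H) : (H ⊗ H) ⊗ H ⟶ (H ⊗ H) ⊗ H) =
      𝟙 _ ⊗≫ H ◁ D.c ⊗≫ (V ⊗≫ D.c ▷ H) := by
    apply D.right_cancel
    refine .trans (by monoidal) (.trans congr(𝟙 _ ⊗≫ $((key' (U ⊗≫ D.c ▷ H)).symm) ⊗≫ 𝟙 _) ?_)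
    refine .trans (by monoidal) (.trans congr(𝟙 _ ⊗≫ H ◁ D.c ⊗≫ $h1 ⊗≫ 𝟙 _) ?_)
    refine .trans (by monoidal) (.trans congr(𝟙 _ ⊗≫ $(key' (V ⊗≫ D.c ▷ H)) ⊗≫ 𝟙 _) ?_)
    monoidal
  rw [← key'' U, h2, key'' V]

/-- The braid equation, which need not be assumed in the presence of an antipode. -/
lemma braid : D.c ▷ H ⊗≫ H ◁ D.c ⊗≫ D.c ▷ H ⊗≫ 𝟙 _ =
    𝟙 _ ⊗≫ H ◁ D.c ⊗≫ D.c ▷ H ⊗≫ H ◁ D.c := by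
  have key : D.smear (𝟙 _ ⊗≫ D.c ▷ H ⊗≫ H ◁ D.c ⊗≫ D.c ▷ H ⊗≫ 𝟙 _) =
      D.smear (H ◁ D.c ⊗≫ D.c ▷ H ⊗≫ H ◁ D.c) := by
    unfold smear
    refine .trans (by monoidal) (.trans congr(𝟙 _ ⊗≫ D.d ▷ (H ⊗ H) ⊗≫ (H ⊗ H) ◁ D.d ▷ H ⊗≫
      H ◁ $(whisker_exchange D.c D.c) ⊗≫ (H ⊗ H) ◁ D.c ▷ H ⊗≫ H ◁ D.c ▷ (H ⊗ H) ⊗≫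
      D.c ▷ (H ⊗ H ⊗ H) ⊗≫ H ◁ D.m ▷ (H ⊗ H) ⊗≫ (H ⊗ H) ◁ D.m ⊗≫ 𝟙 _) ?_)
    refine .trans (by monoidal) (.trans congr(𝟙 _ ⊗≫ D.d ▷ (H ⊗ H) ⊗≫ (H ⊗ H) ◁ D.d ▷ H ⊗≫
      H ◁ D.c ▷ (H ⊗ H) ⊗≫ (H ⊗ H ⊗ H) ◁ D.c ⊗≫ (H ⊗ H) ◁ D.c ▷ H ⊗≫
      $(D.c_m_left.symm) ▷ (H ⊗ H) ⊗≫ (H ⊗ H) ◁ D.m ⊗≫ 𝟙 _) ?_)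
    refine .trans (by monoidal) (.trans congr(𝟙 _ ⊗≫ D.d ▷ (H ⊗ H) ⊗≫ (H ⊗ H) ◁ D.d ▷ H ⊗≫
      H ◁ D.c ▷ (H ⊗ H) ⊗≫ (H ⊗ H ⊗ H) ◁ D.c ⊗≫ (H ⊗ H) ◁ D.c ▷ H ⊗≫
      $((whisker_exchange (D.m ▷ H ≫ D.c) D.m).symm) ⊗≫ 𝟙 _) ?_)
    refine .trans (by monoidal) (.trans congr(𝟙 _ ⊗≫ D.d ▷ (H ⊗ H) ⊗≫ (H ⊗ H) ◁ D.d ▷ H ⊗≫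
      H ◁ D.c ▷ (H ⊗ H) ⊗≫ (H ⊗ H) ◁ $(D.c_m_left.symm) ⊗≫ D.m ▷ (H ⊗ H) ⊗≫
      D.c ▷ H ⊗≫ 𝟙 (H ⊗ H ⊗ H) ⊗≫ 𝟙 _) ?_)
    refine .trans (by monoidal) (.trans congr(𝟙 _ ⊗≫ D.d ▷ (H ⊗ H) ⊗≫ (H ⊗ H) ◁ D.d ▷ H ⊗≫
      H ◁ D.c ▷ (H ⊗ H) ⊗≫ $(whisker_exchange D.m (D.m ▷ H ≫ D.c)) ⊗≫
      D.c ▷ H ⊗≫ 𝟙 (H ⊗ H ⊗ H) ⊗≫ 𝟙 _) ?_)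
    refine .trans (by monoidal) (.trans congr(𝟙 _ ⊗≫ $(D.m_d'.symm) ▷ H ⊗≫ H ◁ D.c ⊗≫ D.c ▷ H ⊗≫
      𝟙 (H ⊗ H ⊗ H) ⊗≫ 𝟙 _) ?_)
    refine .trans (by monoidal) (.trans congr(𝟙 _ ⊗≫ D.m ▷ H ⊗≫ $(D.c_d_left.symm) ⊗≫ 𝟙 _) ?_)
    refine .trans (by monoidal) (.trans congr(𝟙 _ ⊗≫ $(D.c_m_left) ⊗≫ H ◁ D.d ⊗≫ 𝟙 _) ?_)
    refine .trans (by monoidal) (.trans congr(𝟙 _ ⊗≫ H ◁ D.c ⊗≫ D.c ▷ H ⊗≫ H ◁ $(D.m_d') ⊗≫ 𝟙 _) ?_)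
    refine .trans (by monoidal) (.trans congr(𝟙 _ ⊗≫ H ◁ D.c ⊗≫ D.c ▷ H ⊗≫
      H ◁ $((whisker_exchange D.d D.d).symm) ⊗≫ (H ⊗ H) ◁ D.c ▷ H ⊗≫
      H ◁ D.m ▷ (H ⊗ H) ⊗≫ (H ⊗ H) ◁ D.m ⊗≫ 𝟙 _) ?_)
    refine .trans (by monoidal) (.trans congr(𝟙 _ ⊗≫ H ◁ D.c ⊗≫
      $((whisker_exchange D.c D.d).symm) ⊗≫
      H ◁ D.d ▷ (H ⊗ H) ⊗≫ (H ⊗ H) ◁ D.c ▷ H ⊗≫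
      H ◁ D.m ▷ (H ⊗ H) ⊗≫ (H ⊗ H) ◁ D.m ⊗≫ 𝟙 _) ?_)
    refine .trans (by monoidal) (.trans congr(𝟙 _ ⊗≫ H ◁ $(D.c_d_left) ⊗≫
      $(D.c_d_left) ▷ (H ⊗ H) ⊗≫ (H ⊗ H) ◁ D.c ▷ H ⊗≫
      H ◁ D.m ▷ (H ⊗ H) ⊗≫ (H ⊗ H) ◁ D.m ⊗≫ 𝟙 _) ?_)
    refine .trans (by monoidal) (.trans congr(𝟙 _ ⊗≫
      $(whisker_exchange D.d (D.d ▷ H ⊗≫ H ◁ D.c ⊗≫ D.c ▷ H)) ⊗≫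
      H ◁ D.c ▷ (H ⊗ H) ⊗≫ $((whisker_exchange D.c (D.c ▷ H)).symm) ⊗≫
      H ◁ D.m ▷ (H ⊗ H) ⊗≫ (H ⊗ H) ◁ D.m ⊗≫ 𝟙 _) ?_)
    monoidal
  refine .trans (by monoidal) (.trans congr(𝟙 _ ⊗≫ $(D.smear_injective key) ⊗≫ 𝟙 _) ?_)
  monoidal

/-- The laws satisfied by a tensor power `T` of `H`, with its braiding `cT` with `H`, its
  transposition
`sT` past `A`, its comultiplication `dT` and its counit `uT`. -/
structure IsPower {T : C} (cT : H ⊗ T ⟶ T ⊗ H) (sT : T ⊗ A ⟶ A ⊗ T) (dT : T ⟶ T ⊗ T)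
    (uT : T ⟶ 𝟙_ C) : Prop where
  c_e : D.e ▷ T ≫ cT = 𝟙 _ ⊗≫ T ◁ D.e
  c_m : D.m ▷ T ≫ cT = 𝟙 _ ⊗≫ H ◁ cT ⊗≫ cT ▷ H ⊗≫ T ◁ D.m
  c_d : cT ≫ T ◁ D.d = D.d ▷ T ⊗≫ H ◁ cT ⊗≫ cT ▷ H ⊗≫ 𝟙 _
  c_u : cT ≫ T ◁ D.u = D.u ▷ T ⊗≫ 𝟙 _
  c_dT : cT ≫ dT ▷ H = H ◁ dT ⊗≫ cT ▷ T ⊗≫ T ◁ cT ⊗≫ 𝟙 _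
  c_uT : cT ≫ uT ▷ H = H ◁ uT ⊗≫ 𝟙 _
  braid : D.c ▷ T ⊗≫ H ◁ cT ⊗≫ cT ▷ H ⊗≫ 𝟙 _ = 𝟙 _ ⊗≫ H ◁ cT ⊗≫ cT ▷ H ⊗≫ T ◁ D.c
  dT_coassoc : dT ≫ dT ▷ T ≫ (α_ T T T).hom = dT ≫ T ◁ dT
  dT_uT_left : dT ≫ uT ▷ T = (λ_ T).inv
  dT_uT_right : dT ≫ T ◁ uT = (ρ_ T).inv
  sT_r : cT ▷ A ⊗≫ T ◁ D.r ⊗≫ sT = 𝟙 _ ⊗≫ H ◁ sT ⊗≫ D.r ▷ T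

lemma isPower_base : D.IsPower D.c D.s D.d D.u where
  c_e := by rw [D.c_e_left]; monoidal
  c_m := by rw [D.c_m_left]; monoidal
  c_d := by rw [D.c_d_left]; monoidal
  c_u := by
    refine .trans (by monoidal) (.trans congr(𝟙 _ ⊗≫ $(D.c_u_left) ⊗≫ 𝟙 _) ?_)
    monoidal
  c_dT := by rw [D.c_d_right]; monoidal
  c_uT := by
    refine .trans (by monoidal) (.trans congr(𝟙 _ ⊗≫ $(D.c_u_right) ⊗≫ 𝟙 _) ?_)
    monoidal
  braid := D.braid
  dT_coassoc := D.d_coassoc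
  dT_uT_left := D.d_u_left
  dT_uT_right := D.d_u_right
  sT_r := by
    refine .trans (by monoidal) (.trans congr(𝟙 _ ⊗≫ D.c ▷ A ⊗≫ $(D.s_r) ⊗≫ 𝟙 _) ?_)
    refine .trans (by monoidal) (.trans congr(𝟙 _ ⊗≫ $(D.c_c) ▷ A ⊗≫ H ◁ D.s ⊗≫ D.r ▷ H ⊗≫ 𝟙 _) ?_)
    monoidal

variable {T : C} {cT : H ⊗ T ⟶ T ⊗ H} {sT : T ⊗ A ⟶ A ⊗ T} {dT : T ⟶ T ⊗ T} {uT : T ⟶ 𝟙_ C}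

/-- The braiding of `H` with `H ⊗ T`. -/
def consC (cT : H ⊗ T ⟶ T ⊗ H) : H ⊗ H ⊗ T ⟶ (H ⊗ T) ⊗ H :=
  (α_ H H T).inv ≫ D.c ▷ T ≫ (α_ H H T).hom ≫ H ◁ cT ≫ (α_ H T H).inv

/-- The transposition of `H ⊗ T` past `A`. -/
def consS (sT : T ⊗ A ⟶ A ⊗ T) : (H ⊗ T) ⊗ A ⟶ A ⊗ H ⊗ T :=
  (α_ H T A).hom ≫ H ◁ sT ≫ (α_ H A T).inv ≫ D.s ▷ T ≫ (α_ A H T).hom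

/-- The comultiplication of `H ⊗ T`. -/
def consD (cT : H ⊗ T ⟶ T ⊗ H) (dT : T ⟶ T ⊗ T) : H ⊗ T ⟶ (H ⊗ T) ⊗ H ⊗ T :=
  (D.d ⊗ₘ dT) ≫ (α_ H H (T ⊗ T)).hom ≫ H ◁ ((α_ H T T).inv ≫ cT ▷ T ≫ (α_ T H T).hom) ≫
    (α_ H T (H ⊗ T)).inv

/-- The counit of `H ⊗ T`. -/
def consU (uT : T ⟶ 𝟙_ C) : H ⊗ T ⟶ 𝟙_ C := (D.u ⊗ₘ uT) ≫ (λ_ (𝟙_ C)).hom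

lemma consD_eq (cT : H ⊗ T ⟶ T ⊗ H) (dT : T ⟶ T ⊗ T) : D.consD cT dT =
    D.d ▷ T ⊗≫ (H ⊗ H) ◁ dT ⊗≫ H ◁ cT ▷ T ⊗≫ 𝟙 _ := by
  rw [consD, MonoidalCategory.tensorHom_def]
  monoidal

lemma consU_eq (uT : T ⟶ 𝟙_ C) : D.consU uT = D.u ▷ T ⊗≫ uT := by
  rw [consU, MonoidalCategory.tensorHom_def]
  monoidal

section Extension

variable {g g' : T ⟶ A}

lemma compat_ext (hg : H ◁ g ≫ D.s = cT ≫ g ▷ H) :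
    H ◁ (H ◁ g ≫ D.r) ≫ D.s = D.consC cT ≫ (H ◁ g ≫ D.r) ▷ H := by
  unfold consC
  refine .trans (by monoidal) (.trans congr(𝟙 _ ⊗≫ H ◁ H ◁ g ⊗≫ $(D.s_r) ⊗≫ 𝟙 _) ?_)
  refine .trans (by monoidal) (.trans congr(𝟙 _ ⊗≫ $(whisker_exchange D.c g) ⊗≫ H ◁ D.s ⊗≫
    D.r ▷ H ⊗≫ 𝟙 _) ?_)
  refine .trans (by monoidal) (.trans congr(𝟙 _ ⊗≫ D.c ▷ T ⊗≫ H ◁ $(hg) ⊗≫ D.r ▷ H ⊗≫ 𝟙 _) ?_)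
  monoidal

lemma mul_ext (hg : H ◁ g ≫ D.s = cT ≫ g ▷ H) :
    D.consD cT dT ≫ ((H ◁ g ≫ D.r) ⊗ₘ (H ◁ g' ≫ D.r)) ≫ D.mA =
      H ◁ (dT ≫ (g ⊗ₘ g') ≫ D.mA) ≫ D.r := by
  rw [consD_eq, MonoidalCategory.tensorHom_def, MonoidalCategory.tensorHom_def]
  refine .trans (by monoidal) (.trans congr(𝟙 _ ⊗≫ D.d ▷ T ⊗≫ (H ⊗ H) ◁ dT ⊗≫
    H ◁ $(hg.symm) ▷ T ⊗≫ D.r ▷ (H ⊗ T) ⊗≫ A ◁ (H ◁ g' ≫ D.r) ⊗≫ D.mA ⊗≫ 𝟙 _) ?_)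
  refine .trans (by monoidal) (.trans congr(𝟙 _ ⊗≫ D.d ▷ T ⊗≫ (H ⊗ H) ◁ dT ⊗≫
    (H ⊗ H) ◁ g ▷ T ⊗≫ $((whisker_exchange (H ◁ D.s ⊗≫ D.r ▷ H) g').symm) ⊗≫ A ◁ D.r ⊗≫
    D.mA ⊗≫ 𝟙 _) ?_)
  refine .trans (by monoidal) (.trans congr(𝟙 _ ⊗≫
    $((whisker_exchange D.d (dT ≫ g ▷ T ≫ A ◁ g')).symm) ⊗≫ H ◁ D.s ▷ A ⊗≫ D.r ▷ (H ⊗ A) ⊗≫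
    A ◁ D.r ⊗≫ D.mA ⊗≫ 𝟙 _) ?_)
  refine .trans (by monoidal) (.trans congr(𝟙 _ ⊗≫ H ◁ (dT ≫ g ▷ T ≫ A ◁ g') ⊗≫
    $(D.r_mA'.symm) ⊗≫ 𝟙 _) ?_)
  monoidal

lemma unit_ext : H ◁ (uT ≫ D.eA) ≫ D.r = D.consU uT ≫ D.eA := by
  rw [consU_eq]
  refine .trans (by monoidal) (.trans congr(𝟙 _ ⊗≫ H ◁ uT ⊗≫ $(D.r_eA) ⊗≫ 𝟙 _) ?_)
  refine .trans (by monoidal) (.trans congr(𝟙 _ ⊗≫ $(whisker_exchange D.u uT) ⊗≫ D.eA ⊗≫ 𝟙 _) ?_)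
  monoidal

end Extension

variable {D}

namespace IsPower

lemma cons_c_e (G : D.IsPower cT sT dT uT) : D.e ▷ (H ⊗ T) ≫ D.consC cT = 𝟙 _ ⊗≫ (H ⊗ T) ◁ D.e := by
  unfold consC
  refine .trans (by monoidal) (.trans congr(𝟙 _ ⊗≫ $(D.c_e_left) ▷ T ⊗≫ H ◁ cT ⊗≫ 𝟙 _) ?_)
  refine .trans (by monoidal) (.trans congr(𝟙 _ ⊗≫ H ◁ $(G.c_e) ⊗≫ 𝟙 _) ?_)
  monoidal

lemma cons_c_m (G : D.IsPower cT sT dT uT) : D.m ▷ (H ⊗ T) ≫ D.consC cT =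
    𝟙 _ ⊗≫ H ◁ D.consC cT ⊗≫ D.consC cT ▷ H ⊗≫ (H ⊗ T) ◁ D.m := by
  unfold consC
  refine .trans (by monoidal) (.trans congr(𝟙 _ ⊗≫ $(D.c_m_left) ▷ T ⊗≫ H ◁ cT ⊗≫ 𝟙 _) ?_)
  refine .trans (by monoidal) (.trans congr(𝟙 _ ⊗≫ H ◁ D.c ▷ T ⊗≫ D.c ▷ H ▷ T ⊗≫ H ◁ $(G.c_m) ⊗≫
    𝟙 _) ?_)
  refine .trans (by monoidal) (.trans congr(𝟙 _ ⊗≫ H ◁ D.c ▷ T ⊗≫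
    $((whisker_exchange (D.c) (cT)).symm) ⊗≫ H ◁ cT ▷ H ⊗≫ H ◁ T ◁ D.m ⊗≫ 𝟙 _) ?_)
  monoidal

lemma cons_c_d (G : D.IsPower cT sT dT uT) : D.consC cT ≫ (H ⊗ T) ◁ D.d =
    D.d ▷ (H ⊗ T) ⊗≫ H ◁ D.consC cT ⊗≫ D.consC cT ▷ H ⊗≫ 𝟙 _ := by
  unfold consC
  refine .trans (by monoidal) (.trans congr(𝟙 _ ⊗≫ D.c ▷ T ⊗≫ H ◁ $(G.c_d) ⊗≫ 𝟙 _) ?_)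
  refine .trans (by monoidal) (.trans congr(𝟙 _ ⊗≫ $(D.c_d_left) ▷ T ⊗≫ H ◁ H ◁ cT ⊗≫
    H ◁ cT ▷ H ⊗≫ 𝟙 _) ?_)
  refine .trans (by monoidal) (.trans congr(𝟙 _ ⊗≫ D.d ▷ H ▷ T ⊗≫ H ◁ D.c ▷ T ⊗≫
    $((whisker_exchange (D.c) (cT)).symm) ⊗≫ H ◁ cT ▷ H ⊗≫ 𝟙 _) ?_)
  monoidal

lemma cons_c_u (G : D.IsPower cT sT dT uT) : D.consC cT ≫ (H ⊗ T) ◁ D.u = D.u ▷ (H ⊗ T) ⊗≫ 𝟙 _ := by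
  unfold consC
  refine .trans (by monoidal) (.trans congr(𝟙 _ ⊗≫ D.c ▷ T ⊗≫ H ◁ $(G.c_u) ⊗≫ 𝟙 _) ?_)
  refine .trans (by monoidal) (.trans congr(𝟙 _ ⊗≫ $(D.c_u_left) ▷ T ⊗≫ 𝟙 _) ?_)
  monoidal

lemma cons_c_dT (G : D.IsPower cT sT dT uT) : D.consC cT ≫ (D.consD cT dT) ▷ H =
    H ◁ D.consD cT dT ⊗≫ D.consC cT ▷ (H ⊗ T) ⊗≫ (H ⊗ T) ◁ D.consC cT ⊗≫ 𝟙 _ := by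
  rw [consD_eq]; unfold consC
  refine .trans (by monoidal) (.trans congr(𝟙 _ ⊗≫ D.c ▷ T ⊗≫ $(whisker_exchange (D.d) (cT)) ⊗≫
    (H ⊗ H) ◁ dT ▷ H ⊗≫ H ◁ cT ▷ (T ⊗ H) ⊗≫ 𝟙 _) ?_)
  refine .trans (by monoidal) (.trans congr(𝟙 _ ⊗≫ $(D.c_d_right) ▷ T ⊗≫ (H ⊗ H) ◁ $(G.c_dT) ⊗≫
    H ◁ cT ▷ (T ⊗ H) ⊗≫ 𝟙 _) ?_)
  refine .trans (by monoidal) (.trans congr(𝟙 _ ⊗≫ H ◁ D.d ▷ T ⊗≫ $((whisker_exchange (D.c ▷ H ⊗≫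
    H ◁ D.c) (dT)).symm) ⊗≫ (H ⊗ H) ◁ cT ▷ T ⊗≫ (H ⊗ H) ◁ T ◁ cT ⊗≫ H ◁ cT ▷ (T ⊗ H) ⊗≫ 𝟙 _) ?_)
  refine .trans (by monoidal) (.trans congr(𝟙 _ ⊗≫ H ◁ D.d ▷ T ⊗≫ (H ⊗ H ⊗ H) ◁ dT ⊗≫
    D.c ▷ H ▷ (T ⊗ T) ⊗≫ H ◁ D.c ▷ (T ⊗ T) ⊗≫ (H ⊗ H) ◁ cT ▷ T ⊗≫
    H ◁ $(whisker_exchange (cT) (cT)) ⊗≫ 𝟙 _) ?_)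
  refine .trans (by monoidal) (.trans congr(𝟙 _ ⊗≫ H ◁ D.d ▷ T ⊗≫ (H ⊗ H ⊗ H) ◁ dT ⊗≫
    D.c ▷ H ▷ (T ⊗ T) ⊗≫ H ◁ $(G.braid) ▷ T ⊗≫ (H ⊗ T ⊗ H) ◁ cT ⊗≫ 𝟙 _) ?_)
  refine .trans (by monoidal) (.trans congr(𝟙 _ ⊗≫ H ◁ D.d ▷ T ⊗≫ (H ⊗ H ⊗ H) ◁ dT ⊗≫
    $((whisker_exchange (D.c) (cT ▷ T)).symm) ⊗≫ H ◁ cT ▷ H ▷ T ⊗≫ H ◁ T ◁ D.c ▷ T ⊗≫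
    (H ⊗ T ⊗ H) ◁ cT ⊗≫ 𝟙 _) ?_)
  monoidal

lemma cons_c_uT (G : D.IsPower cT sT dT uT) : D.consC cT ≫ (D.consU uT) ▷ H = H ◁ D.consU uT ⊗≫
  𝟙 _ := by
  rw [consU_eq]; unfold consC
  refine .trans (by monoidal) (.trans congr(𝟙 _ ⊗≫ D.c ▷ T ⊗≫ $(whisker_exchange (D.u) (cT)) ⊗≫
    uT ▷ H ⊗≫ 𝟙 _) ?_)
  refine .trans (by monoidal) (.trans congr(𝟙 _ ⊗≫ $(D.c_u_right) ▷ T ⊗≫ cT ⊗≫ uT ▷ H ⊗≫ 𝟙 _) ?_)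
  refine .trans (by monoidal) (.trans congr(𝟙 _ ⊗≫ H ◁ D.u ▷ T ⊗≫ $(G.c_uT) ⊗≫ 𝟙 _) ?_)
  monoidal

lemma cons_braid (G : D.IsPower cT sT dT uT) : D.c ▷ (H ⊗ T) ⊗≫ H ◁ D.consC cT ⊗≫
  D.consC cT ▷ H ⊗≫ 𝟙 _ =
    𝟙 _ ⊗≫ H ◁ D.consC cT ⊗≫ D.consC cT ▷ H ⊗≫ (H ⊗ T) ◁ D.c := by
  unfold consC
  refine .trans (by monoidal) (.trans congr(𝟙 _ ⊗≫ D.c ▷ H ▷ T ⊗≫ H ◁ D.c ▷ T ⊗≫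
    $(whisker_exchange (D.c) (cT)) ⊗≫ H ◁ cT ▷ H ⊗≫ 𝟙 _) ?_)
  refine .trans (by monoidal) (.trans congr(𝟙 _ ⊗≫ $(D.braid) ▷ T ⊗≫ H ◁ H ◁ cT ⊗≫ H ◁ cT ▷ H ⊗≫
    𝟙 _) ?_)
  refine .trans (by monoidal) (.trans congr(𝟙 _ ⊗≫ H ◁ D.c ▷ T ⊗≫ D.c ▷ H ▷ T ⊗≫ H ◁ $(G.braid) ⊗≫
    𝟙 _) ?_)
  refine .trans (by monoidal) (.trans congr(𝟙 _ ⊗≫ H ◁ D.c ▷ T ⊗≫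
    $((whisker_exchange (D.c) (cT)).symm) ⊗≫ H ◁ cT ▷ H ⊗≫ H ◁ T ◁ D.c ⊗≫ 𝟙 _) ?_)
  monoidal

lemma cons_dT_coassoc (G : D.IsPower cT sT dT uT) :
  D.consD cT dT ≫ (D.consD cT dT) ▷ (H ⊗ T) ≫ (α_ (H ⊗ T) (H ⊗ T) (H ⊗ T)).hom =
    D.consD cT dT ≫ (H ⊗ T) ◁ D.consD cT dT := by
  rw [consD_eq]
  trans D.d ▷ T ⊗≫ H ◁ D.d ▷ T ⊗≫ (H ⊗ H ⊗ H) ◁ dT ⊗≫ (H ⊗ H ⊗ H) ◁ T ◁ dT ⊗≫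
    (H ⊗ H) ◁ cT ▷ (T ⊗ T) ⊗≫ (H ⊗ H ⊗ T) ◁ cT ▷ T ⊗≫ H ◁ cT ▷ (T ⊗ H ⊗ T) ⊗≫ 𝟙 _
  · refine .trans (by monoidal) (.trans congr(𝟙 _ ⊗≫ D.d ▷ T ⊗≫ (H ⊗ H) ◁ dT ⊗≫
    $(whisker_exchange (D.d) (cT ▷ T)) ⊗≫ (H ⊗ H) ◁ dT ▷ (H ⊗ T) ⊗≫ H ◁ cT ▷ (T ⊗ H ⊗ T) ⊗≫ 𝟙 _) ?_)
    refine .trans (by monoidal) (.trans congr(𝟙 _ ⊗≫ D.d ▷ T ⊗≫ (H ⊗ H) ◁ dT ⊗≫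
      D.d ▷ (H ⊗ T ⊗ T) ⊗≫ (H ⊗ H) ◁ $(G.c_dT) ▷ T ⊗≫ H ◁ cT ▷ (T ⊗ H ⊗ T) ⊗≫ 𝟙 _) ?_)
    refine .trans (by monoidal) (.trans congr(𝟙 _ ⊗≫ D.d ▷ T ⊗≫
      $(whisker_exchange (D.d ▷ H) (dT)) ⊗≫ (H ⊗ H) ◁ H ◁ dT ▷ T ⊗≫ (H ⊗ H) ◁ cT ▷ (T ⊗ T) ⊗≫
      (H ⊗ H ⊗ T) ◁ cT ▷ T ⊗≫ H ◁ cT ▷ (T ⊗ H ⊗ T) ⊗≫ 𝟙 _) ?_)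
    refine .trans (by monoidal) (.trans congr(𝟙 _ ⊗≫ $(D.d_coassoc) ▷ T ⊗≫
      (H ⊗ H ⊗ H) ◁ $(G.dT_coassoc) ⊗≫ (H ⊗ H) ◁ cT ▷ (T ⊗ T) ⊗≫ (H ⊗ H ⊗ T) ◁ cT ▷ T ⊗≫
      H ◁ cT ▷ (T ⊗ H ⊗ T) ⊗≫ 𝟙 _) ?_)
    monoidal
  · symm
    refine .trans (by monoidal) (.trans congr(𝟙 _ ⊗≫ D.d ▷ T ⊗≫ (H ⊗ H) ◁ dT ⊗≫
      H ◁ $(G.c_d) ▷ T ⊗≫ (H ⊗ T ⊗ H ⊗ H) ◁ dT ⊗≫ (H ⊗ T ⊗ H) ◁ cT ▷ T ⊗≫ 𝟙 _) ?_)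
    refine .trans (by monoidal) (.trans congr(𝟙 _ ⊗≫ D.d ▷ T ⊗≫ (H ⊗ H) ◁ dT ⊗≫
      H ◁ D.d ▷ (T ⊗ T) ⊗≫ $((whisker_exchange (H ◁ H ◁ cT ⊗≫ H ◁ cT ▷ H) (dT)).symm) ⊗≫
      (H ⊗ T ⊗ H) ◁ cT ▷ T ⊗≫ 𝟙 _) ?_)
    refine .trans (by monoidal) (.trans congr(𝟙 _ ⊗≫ D.d ▷ T ⊗≫
      $(whisker_exchange (H ◁ D.d) (dT)) ⊗≫ (H ⊗ H ⊗ H) ◁ T ◁ dT ⊗≫ (H ⊗ H) ◁ cT ▷ (T ⊗ T) ⊗≫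
      H ◁ cT ▷ (H ⊗ T ⊗ T) ⊗≫ (H ⊗ T ⊗ H) ◁ cT ▷ T ⊗≫ 𝟙 _) ?_)
    refine .trans (by monoidal) (.trans congr(𝟙 _ ⊗≫ D.d ▷ T ⊗≫ H ◁ D.d ▷ T ⊗≫ (H ⊗ H ⊗ H) ◁ dT ⊗≫
      (H ⊗ H ⊗ H) ◁ T ◁ dT ⊗≫ (H ⊗ H) ◁ cT ▷ (T ⊗ T) ⊗≫
      H ◁ $((whisker_exchange (cT) (cT ▷ T)).symm) ⊗≫ 𝟙 _) ?_)
    monoidal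

lemma cons_dT_uT_left (G : D.IsPower cT sT dT uT) : D.consD cT dT ≫ (D.consU uT) ▷ (H ⊗ T) =
  (λ_ (H ⊗ T)).inv := by
  rw [consD_eq, consU_eq]
  refine .trans (by monoidal) (.trans congr(𝟙 _ ⊗≫ D.d ▷ T ⊗≫ $(whisker_exchange (D.u) (H ◁ dT ⊗≫
    cT ▷ T)) ⊗≫ uT ▷ (H ⊗ T) ⊗≫ 𝟙 _) ?_)
  refine .trans (by monoidal) (.trans congr(𝟙 _ ⊗≫ $(D.d_u_left) ▷ T ⊗≫ H ◁ dT ⊗≫ $(G.c_uT) ▷ T ⊗≫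
    𝟙 _) ?_)
  refine .trans (by monoidal) (.trans congr(𝟙 _ ⊗≫ H ◁ $(G.dT_uT_left) ⊗≫ 𝟙 _) ?_)
  monoidal

lemma cons_dT_uT_right (G : D.IsPower cT sT dT uT) : D.consD cT dT ≫ (H ⊗ T) ◁ D.consU uT =
  (ρ_ (H ⊗ T)).inv := by
  rw [consD_eq, consU_eq]
  refine .trans (by monoidal) (.trans congr(𝟙 _ ⊗≫ D.d ▷ T ⊗≫ (H ⊗ H) ◁ dT ⊗≫ H ◁ $(G.c_u) ▷ T ⊗≫
    (H ⊗ T) ◁ uT ⊗≫ 𝟙 _) ?_)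
  refine .trans (by monoidal) (.trans congr(𝟙 _ ⊗≫ D.d ▷ T ⊗≫
    $(whisker_exchange (H ◁ D.u) (dT)) ⊗≫ (H ⊗ T) ◁ uT ⊗≫ 𝟙 _) ?_)
  refine .trans (by monoidal) (.trans congr(𝟙 _ ⊗≫ $(D.d_u_right) ▷ T ⊗≫ H ◁ $(G.dT_uT_right) ⊗≫
    𝟙 _) ?_)
  monoidal

lemma cons_sT_r (G : D.IsPower cT sT dT uT) : (D.consC cT) ▷ A ⊗≫ (H ⊗ T) ◁ D.r ⊗≫ D.consS sT =
    𝟙 _ ⊗≫ H ◁ D.consS sT ⊗≫ D.r ▷ (H ⊗ T) := by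
  unfold consC consS
  refine .trans (by monoidal) (.trans congr(𝟙 _ ⊗≫ D.c ▷ T ▷ A ⊗≫ H ◁ $(G.sT_r) ⊗≫ D.s ▷ T ⊗≫
    𝟙 _) ?_)
  refine .trans (by monoidal) (.trans congr(𝟙 _ ⊗≫ $((whisker_exchange (D.c) (sT)).symm) ⊗≫
    H ◁ D.r ▷ T ⊗≫ D.s ▷ T ⊗≫ 𝟙 _) ?_)
  refine .trans (by monoidal) (.trans congr(𝟙 _ ⊗≫ H ◁ H ◁ sT ⊗≫ $(D.isPower_base.sT_r) ▷ T ⊗≫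
    𝟙 _) ?_)
  monoidal

lemma cons (G : D.IsPower cT sT dT uT) :
  D.IsPower (D.consC cT) (D.consS sT) (D.consD cT dT) (D.consU uT) where
  c_e := .trans (by monoidal) (.trans G.cons_c_e (by monoidal))
  c_m := .trans (by monoidal) (.trans G.cons_c_m (by monoidal))
  c_d := .trans (by monoidal) (.trans G.cons_c_d (by monoidal))
  c_u := .trans (by monoidal) (.trans G.cons_c_u (by monoidal))
  c_dT := .trans (by monoidal) (.trans G.cons_c_dT (by monoidal))
  c_uT := .trans (by monoidal) (.trans G.cons_c_uT (by monoidal))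
  braid := .trans (by monoidal) (.trans G.cons_braid (by monoidal))
  dT_coassoc := G.cons_dT_coassoc
  dT_uT_left := G.cons_dT_uT_left
  dT_uT_right := G.cons_dT_uT_right
  sT_r := .trans (by monoidal) (.trans G.cons_sT_r (by monoidal))

section Extension

variable {g g' : T ⟶ A}

lemma compat_inv (G : D.IsPower cT sT dT uT) (hg : H ◁ g ≫ D.s = cT ≫ g ▷ H)
    (h₁ : dT ≫ (g ⊗ₘ g') ≫ D.mA = uT ≫ D.eA) (h₂ : dT ≫ (g' ⊗ₘ g) ≫ D.mA = uT ≫ D.eA) :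
    H ◁ g' ≫ D.s = cT ≫ g' ▷ H := by
  rw [MonoidalCategory.tensorHom_def] at h₁ h₂
  have left : (H ◁ dT ⊗≫ cT ▷ T ⊗≫ T ◁ (H ◁ g' ≫ D.s)) ⊗≫ g ▷ (A ⊗ H) ⊗≫ D.mA ▷ H =
      H ◁ uT ⊗≫ D.eA ▷ H := by
    refine .trans (by monoidal) (.trans congr(𝟙 _ ⊗≫ H ◁ dT ⊗≫ cT ▷ T ⊗≫
      $(whisker_exchange g (H ◁ g' ≫ D.s)) ⊗≫ D.mA ▷ H ⊗≫ 𝟙 _) ?_)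
    refine .trans (by monoidal) (.trans congr(𝟙 _ ⊗≫ H ◁ dT ⊗≫ $(hg.symm) ▷ T ⊗≫
      A ◁ (H ◁ g' ≫ D.s) ⊗≫ D.mA ▷ H ⊗≫ 𝟙 _) ?_)
    refine .trans (by monoidal) (.trans congr(𝟙 _ ⊗≫ H ◁ dT ⊗≫ H ◁ g ▷ T ⊗≫
      $((whisker_exchange D.s g').symm) ⊗≫ A ◁ D.s ⊗≫ D.mA ▷ H ⊗≫ 𝟙 _) ?_)
    refine .trans (by monoidal) (.trans congr(𝟙 _ ⊗≫ H ◁ dT ⊗≫ H ◁ g ▷ T ⊗≫ H ◁ A ◁ g' ⊗≫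
      $(D.s_mA.symm) ⊗≫ 𝟙 _) ?_)
    refine .trans (by monoidal) (.trans congr(𝟙 _ ⊗≫ H ◁ $(h₁) ⊗≫ D.s ⊗≫ 𝟙 _) ?_)
    refine .trans (by monoidal) (.trans congr(𝟙 _ ⊗≫ H ◁ uT ⊗≫ $(D.s_eA) ⊗≫ 𝟙 _) ?_)
    monoidal
  symm
  refine .trans (by monoidal) (.trans congr(𝟙 _ ⊗≫ H ◁ $(G.dT_uT_right.symm) ⊗≫ cT ⊗≫
    g' ▷ H ⊗≫ 𝟙 _) ?_)
  refine .trans (by monoidal) (.trans congr(𝟙 _ ⊗≫ H ◁ dT ⊗≫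
    $(whisker_exchange (cT ≫ g' ▷ H) uT) ⊗≫ 𝟙 _) ?_)
  refine .trans (by monoidal) (.trans congr(𝟙 _ ⊗≫ H ◁ dT ⊗≫ cT ▷ T ⊗≫ g' ▷ (H ⊗ T) ⊗≫
    (A ⊗ H) ◁ uT ⊗≫ $(D.mA_eA.symm) ▷ H ⊗≫ 𝟙 _) ?_)
  refine .trans (by monoidal) (.trans congr(𝟙 _ ⊗≫ H ◁ dT ⊗≫ cT ▷ T ⊗≫ g' ▷ (H ⊗ T) ⊗≫
    A ◁ $(left.symm) ⊗≫ D.mA ▷ H ⊗≫ 𝟙 _) ?_)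
  refine .trans (by monoidal) (.trans congr(𝟙 _ ⊗≫ H ◁ dT ⊗≫ cT ▷ T ⊗≫ g' ▷ (H ⊗ T) ⊗≫
    A ◁ (H ◁ dT ⊗≫ cT ▷ T ⊗≫ T ◁ (H ◁ g' ≫ D.s)) ⊗≫ A ◁ g ▷ (A ⊗ H) ⊗≫
    $(D.mA_assoc.symm) ▷ H ⊗≫ 𝟙 _) ?_)
  refine .trans (by monoidal) (.trans congr(𝟙 _ ⊗≫ H ◁ dT ⊗≫ cT ▷ T ⊗≫
    $((whisker_exchange g' (H ◁ dT ⊗≫ cT ▷ T ⊗≫ T ◁ (H ◁ g' ≫ D.s))).symm) ⊗≫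
    A ◁ g ▷ (A ⊗ H) ⊗≫ D.mA ▷ A ▷ H ⊗≫ D.mA ▷ H ⊗≫ 𝟙 _) ?_)
  refine .trans (by monoidal) (.trans congr(𝟙 _ ⊗≫ H ◁ dT ⊗≫ cT ▷ T ⊗≫
    T ◁ (H ◁ dT ⊗≫ cT ▷ T) ⊗≫ $(whisker_exchange (g' ▷ T ≫ A ◁ g ≫ D.mA) (H ◁ g' ≫ D.s)) ⊗≫
    D.mA ▷ H ⊗≫ 𝟙 _) ?_)
  refine .trans (by monoidal) (.trans congr(𝟙 _ ⊗≫ H ◁ dT ⊗≫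
    $((whisker_exchange cT dT).symm) ⊗≫ T ◁ cT ▷ T ⊗≫
    (g' ▷ T ≫ A ◁ g ≫ D.mA) ▷ (H ⊗ T) ⊗≫ A ◁ (H ◁ g' ≫ D.s) ⊗≫ D.mA ▷ H ⊗≫ 𝟙 _) ?_)
  refine .trans (by monoidal) (.trans congr(𝟙 _ ⊗≫ H ◁ $(G.dT_coassoc.symm) ⊗≫
    cT ▷ (T ⊗ T) ⊗≫ T ◁ cT ▷ T ⊗≫
    (g' ▷ T ≫ A ◁ g ≫ D.mA) ▷ (H ⊗ T) ⊗≫ A ◁ (H ◁ g' ≫ D.s) ⊗≫ D.mA ▷ H ⊗≫ 𝟙 _) ?_)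
  refine .trans (by monoidal) (.trans congr(𝟙 _ ⊗≫ H ◁ dT ⊗≫ $(G.c_dT.symm) ▷ T ⊗≫
    (g' ▷ T ≫ A ◁ g ≫ D.mA) ▷ (H ⊗ T) ⊗≫ A ◁ (H ◁ g' ≫ D.s) ⊗≫ D.mA ▷ H ⊗≫ 𝟙 _) ?_)
  refine .trans (by monoidal) (.trans congr(𝟙 _ ⊗≫ H ◁ dT ⊗≫ cT ▷ T ⊗≫ $(h₂) ▷ (H ⊗ T) ⊗≫
    A ◁ (H ◁ g' ≫ D.s) ⊗≫ D.mA ▷ H ⊗≫ 𝟙 _) ?_)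
  refine .trans (by monoidal) (.trans congr(𝟙 _ ⊗≫ H ◁ dT ⊗≫ $(G.c_uT) ▷ T ⊗≫
    D.eA ▷ (H ⊗ T) ⊗≫ A ◁ (H ◁ g' ≫ D.s) ⊗≫ D.mA ▷ H ⊗≫ 𝟙 _) ?_)
  refine .trans (by monoidal) (.trans congr(𝟙 _ ⊗≫ H ◁ $(G.dT_uT_left) ⊗≫
    $((whisker_exchange D.eA (H ◁ g' ≫ D.s)).symm) ⊗≫ D.mA ▷ H ⊗≫ 𝟙 _) ?_)
  refine .trans (by monoidal) (.trans congr(𝟙 _ ⊗≫ H ◁ g' ⊗≫ D.s ⊗≫ $(D.eA_mA) ▷ H ⊗≫ 𝟙 _) ?_)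
  monoidal

/-- Half of the central condition can be tested after this operator, since it is split epi. -/
lemma spread_cancel (G : D.IsPower cT sT dT uT) {Y : C} {p q : (H ⊗ T) ⊗ A ⟶ Y}
    (h : D.d ▷ (T ⊗ A) ⊗≫ H ◁ (cT ▷ A ⊗≫ T ◁ D.r) ⊗≫ p =
      D.d ▷ (T ⊗ A) ⊗≫ H ◁ (cT ▷ A ⊗≫ T ◁ D.r) ⊗≫ q) : p = q := by
  have key : ∀ p : (H ⊗ T) ⊗ A ⟶ Y,
      𝟙 _ ⊗≫ D.d ▷ (T ⊗ A) ⊗≫ H ◁ D.S ▷ (T ⊗ A) ⊗≫ H ◁ (cT ▷ A ⊗≫ T ◁ D.r) ⊗≫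
        (D.d ▷ (T ⊗ A) ⊗≫ H ◁ (cT ▷ A ⊗≫ T ◁ D.r) ⊗≫ p) = p := by
    intro p
    refine .trans (by monoidal) (.trans congr(𝟙 _ ⊗≫ D.d ▷ (T ⊗ A) ⊗≫
      $(whisker_exchange D.d (D.S ▷ (T ⊗ A) ⊗≫ cT ▷ A ⊗≫ T ◁ D.r)) ⊗≫
      H ◁ (cT ▷ A ⊗≫ T ◁ D.r) ⊗≫ p) ?_)
    refine .trans (by monoidal) (.trans congr(𝟙 _ ⊗≫ $(D.d_coassoc) ▷ (T ⊗ A) ⊗≫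
      (H ⊗ H) ◁ D.S ▷ (T ⊗ A) ⊗≫ (H ⊗ H) ◁ cT ▷ A ⊗≫ H ◁ $(whisker_exchange cT D.r) ⊗≫
      (H ⊗ T) ◁ D.r ⊗≫ p) ?_)
    refine .trans (by monoidal) (.trans congr(𝟙 _ ⊗≫ D.d ▷ (T ⊗ A) ⊗≫ H ◁ D.d ▷ (T ⊗ A) ⊗≫
      (H ⊗ H) ◁ D.S ▷ (T ⊗ A) ⊗≫ (H ⊗ H) ◁ cT ▷ A ⊗≫ H ◁ cT ▷ (H ⊗ A) ⊗≫
      (H ⊗ T) ◁ $(D.r_m.symm) ⊗≫ p) ?_)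
    refine .trans (by monoidal) (.trans congr(𝟙 _ ⊗≫ D.d ▷ (T ⊗ A) ⊗≫ H ◁ D.d ▷ (T ⊗ A) ⊗≫
      (H ⊗ H) ◁ D.S ▷ (T ⊗ A) ⊗≫ H ◁ $(G.c_m.symm) ▷ A ⊗≫ (H ⊗ T) ◁ D.r ⊗≫ p) ?_)
    refine .trans (by monoidal) (.trans congr(𝟙 _ ⊗≫ D.d ▷ (T ⊗ A) ⊗≫
      H ◁ $(D.S_right) ▷ (T ⊗ A) ⊗≫ H ◁ cT ▷ A ⊗≫ (H ⊗ T) ◁ D.r ⊗≫ p) ?_)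
    refine .trans (by monoidal) (.trans congr(𝟙 _ ⊗≫ $(D.d_u_right) ▷ (T ⊗ A) ⊗≫
      H ◁ $(G.c_e) ▷ A ⊗≫ (H ⊗ T) ◁ D.r ⊗≫ p) ?_)
    refine .trans (by monoidal) (.trans congr(𝟙 _ ⊗≫ (H ⊗ T) ◁ $(D.r_e) ⊗≫ p) ?_)
    monoidal
  rw [← key p, h, key q]

lemma central_ext (G : D.IsPower cT sT dT uT) (hg : H ◁ g ≫ D.s = cT ≫ g ▷ H)
    (hc : sT ≫ A ◁ g ≫ D.mA = g ▷ A ≫ D.mA) :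
    D.consS sT ≫ A ◁ (H ◁ g ≫ D.r) ≫ D.mA = (H ◁ g ≫ D.r) ▷ A ≫ D.mA := by
  refine G.spread_cancel ?_
  trans 𝟙 _ ⊗≫ H ◁ (g ▷ A ≫ D.mA) ⊗≫ D.r
  · unfold consS
    refine .trans (by monoidal) (.trans congr(𝟙 _ ⊗≫ D.d ▷ (T ⊗ A) ⊗≫ H ◁ $(G.sT_r) ⊗≫
      D.s ▷ T ⊗≫ A ◁ (H ◁ g ≫ D.r) ⊗≫ D.mA ⊗≫ 𝟙 _) ?_)
    refine .trans (by monoidal) (.trans congr(𝟙 _ ⊗≫ D.d ▷ (T ⊗ A) ⊗≫ (H ⊗ H) ◁ sT ⊗≫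
      $(D.s_r) ▷ T ⊗≫ A ◁ (H ◁ g ≫ D.r) ⊗≫ D.mA ⊗≫ 𝟙 _) ?_)
    refine .trans (by monoidal) (.trans congr(𝟙 _ ⊗≫
      $((whisker_exchange D.d sT).symm) ⊗≫ D.c ▷ (A ⊗ T) ⊗≫ H ◁ D.s ▷ T ⊗≫ D.r ▷ (H ⊗ T) ⊗≫
      A ◁ (H ◁ g ≫ D.r) ⊗≫ D.mA ⊗≫ 𝟙 _) ?_)
    refine .trans (by monoidal) (.trans congr(𝟙 _ ⊗≫ H ◁ sT ⊗≫ $(D.d_c) ▷ (A ⊗ T) ⊗≫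
      H ◁ D.s ▷ T ⊗≫ D.r ▷ (H ⊗ T) ⊗≫ A ◁ (H ◁ g ≫ D.r) ⊗≫ D.mA ⊗≫ 𝟙 _) ?_)
    refine .trans (by monoidal) (.trans congr(𝟙 _ ⊗≫ H ◁ sT ⊗≫
      $((whisker_exchange (D.d ▷ A ⊗≫ H ◁ D.s ⊗≫ D.r ▷ H) g).symm) ⊗≫ A ◁ D.r ⊗≫
      D.mA ⊗≫ 𝟙 _) ?_)
    refine .trans (by monoidal) (.trans congr(𝟙 _ ⊗≫ H ◁ sT ⊗≫ H ◁ A ◁ g ⊗≫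
      $(D.r_mA'.symm) ⊗≫ 𝟙 _) ?_)
    refine .trans (by monoidal) (.trans congr(𝟙 _ ⊗≫ H ◁ $(hc) ⊗≫ D.r ⊗≫ 𝟙 _) ?_)
    monoidal
  · symm
    refine .trans (by monoidal) (.trans congr(𝟙 _ ⊗≫ D.d ▷ (T ⊗ A) ⊗≫ H ◁ cT ▷ A ⊗≫
      $(whisker_exchange (H ◁ g ≫ D.r) D.r) ⊗≫ D.mA ⊗≫ 𝟙 _) ?_)
    refine .trans (by monoidal) (.trans congr(𝟙 _ ⊗≫ D.d ▷ (T ⊗ A) ⊗≫ H ◁ $(hg.symm) ▷ A ⊗≫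
      D.r ▷ (H ⊗ A) ⊗≫ A ◁ D.r ⊗≫ D.mA ⊗≫ 𝟙 _) ?_)
    refine .trans (by monoidal) (.trans congr(𝟙 _ ⊗≫ $((whisker_exchange D.d (g ▷ A)).symm) ⊗≫
      H ◁ D.s ▷ A ⊗≫ D.r ▷ (H ⊗ A) ⊗≫ A ◁ D.r ⊗≫ D.mA ⊗≫ 𝟙 _) ?_)
    refine .trans (by monoidal) (.trans congr(𝟙 _ ⊗≫ H ◁ g ▷ A ⊗≫ $(D.r_mA'.symm) ⊗≫ 𝟙 _) ?_)
    monoidal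

end Extension

end IsPower

end BraidedAction
end MonoidalAction

section Instantiation

open CategoryTheory MonoidalCategory

/-- The structure maps of a cocommutative braided Hopf algebra and a module algebra over it, as
morphisms of the category of modules. -/
def ModAlgData.toBraidedAction (D : ModAlgData k' H' A') (hcc : D.Cocomm) :
    BraidedAction (ModuleCat.of k' H') (ModuleCat.of k' A') where
  m := ModuleCat.ofHom (LinearMap.mul' k' H')
  e := ModuleCat.ofHom (Algebra.linearMap k' H')
  d := ModuleCat.ofHom (Coalgebra.comul (R := k'))
  u := ModuleCat.ofHom (Coalgebra.counit (R := k'))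
  S := ModuleCat.ofHom D.antipode
  c := ModuleCat.ofHom D.c
  mA := ModuleCat.ofHom (LinearMap.mul' k' A')
  eA := ModuleCat.ofHom (Algebra.linearMap k' A')
  s := ModuleCat.ofHom D.s
  r := ModuleCat.ofHom D.ρ
  m_assoc := ModuleCat.hom_ext <| TensorProduct.ext_threefold fun x y z => mul_assoc x y z
  e_m := ModuleCat.hom_ext <| TensorProduct.ext' fun r x => (Algebra.smul_def r x).symm
  m_e := ModuleCat.hom_ext <| TensorProduct.ext' fun x r =>
    (Algebra.commutes r x).symm.trans (Algebra.smul_def r x).symm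
  d_coassoc := ModuleCat.hom_ext Coalgebra.coassoc
  d_u_left := ModuleCat.hom_ext Coalgebra.rTensor_counit_comp_comul
  d_u_right := ModuleCat.hom_ext Coalgebra.lTensor_counit_comp_comul
  c_e_left := ModuleCat.hom_ext <| TensorProduct.ext' fun r x => by
    change D.c (algebraMap k' H' r ⊗ₜ x) = (r • x) ⊗ₜ algebraMap k' H' 1
    rw [Algebra.algebraMap_eq_smul_one, ← smul_tmul', map_smul, D.c_one_left, map_one, smul_tmul']
  c_m_left := ModuleCat.hom_ext D.c_mul_left
  c_d_left := ModuleCat.hom_ext D.c_comul_left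
  c_d_right := ModuleCat.hom_ext D.c_comul_right
  c_u_left := ModuleCat.hom_ext D.c_counit_left
  c_u_right := ModuleCat.hom_ext D.c_counit_right
  m_d := ModuleCat.hom_ext D.comul_mul
  S_left := ModuleCat.hom_ext D.antipode_left
  S_right := ModuleCat.hom_ext D.antipode_right
  c_c := ModuleCat.hom_ext hcc.1
  d_c := ModuleCat.hom_ext hcc.2
  mA_assoc := ModuleCat.hom_ext <| TensorProduct.ext_threefold fun x y z => mul_assoc x y z
  eA_mA := ModuleCat.hom_ext <| TensorProduct.ext' fun r x => (Algebra.smul_def r x).symm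
  mA_eA := ModuleCat.hom_ext <| TensorProduct.ext' fun x r =>
    (Algebra.commutes r x).symm.trans (Algebra.smul_def r x).symm
  s_e := ModuleCat.hom_ext <| TensorProduct.ext' fun r a => by
    change D.s (algebraMap k' H' r ⊗ₜ a) = (r • a) ⊗ₜ algebraMap k' H' 1
    rw [Algebra.algebraMap_eq_smul_one, ← smul_tmul', map_smul, D.s_one_left, map_one, smul_tmul']
  s_eA := ModuleCat.hom_ext <| TensorProduct.ext' fun x r => by
    change D.s (x ⊗ₜ algebraMap k' A' r) = algebraMap k' A' 1 ⊗ₜ (r • x)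
    rw [Algebra.algebraMap_eq_smul_one, tmul_smul, map_smul, D.s_one_right, map_one, tmul_smul]
  s_mA := ModuleCat.hom_ext D.s_mul_A
  r_e := ModuleCat.hom_ext <| TensorProduct.ext' fun r a => by
    change D.ρ (algebraMap k' H' r ⊗ₜ a) = r • a
    rw [Algebra.algebraMap_eq_smul_one, ← smul_tmul', map_smul, D.ρ_one]
  r_m := ModuleCat.hom_ext D.ρ_mul
  s_r := ModuleCat.hom_ext D.s_ρ
  r_mA := ModuleCat.hom_ext D.ρ_mul_A
  r_eA := ModuleCat.hom_ext <| TensorProduct.ext' fun x r => by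
    change D.ρ (x ⊗ₜ algebraMap k' A' r) =
      algebraMap k' A' (Coalgebra.counit (R := k') (r • x))
    rw [Algebra.algebraMap_eq_smul_one, tmul_smul, map_smul, D.ρ_unit, map_smul,
      Algebra.algebraMap_eq_smul_one, smul_assoc]

lemma ModAlgData.isPower (D : ModAlgData k' H' A') (hcc : D.Cocomm) (n : ℕ) :
    (D.toBraidedAction hcc).IsPower (T := TPowM k' H' n) (ModuleCat.ofHom (cPow D n))
      (ModuleCat.ofHom (sPow D n)) (ModuleCat.ofHom (comulPow D n))
      (ModuleCat.ofHom (counitPow k' H' n)) := by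
  induction n with
  | zero => exact BraidedAction.isPower_base _
  | succ n ih =>
    have hu : ModuleCat.ofHom (counitPow k' H' (n + 1)) =
        (D.toBraidedAction hcc).consU (ModuleCat.ofHom (counitPow k' H' n)) :=
      ModuleCat.hom_ext <| TensorProduct.ext' fun _ _ => rfl
    exact hu ▸ ih.cons

variable (D : ModAlgData k' H' A') (n : ℕ)

/-- The inclusion `x ↦ 1 ⊗ x` of `H^{⊗(n+1)}` in `H^{⊗(n+2)}`. -/
def oneTmul (k H : Type) [Field k] [Ring H] [Algebra k H] (n : ℕ) :
    TPow k H n →ₗ[k] TPow k H (n + 1) :=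
  TensorProduct.mk k H (TPow k H n) 1

lemma cPow_succ_tmul (h l : H') (x : TPow k' H' n) :
    cPow D (n + 1) (h ⊗ₜ[k'] (l ⊗ₜ[k'] x : H' ⊗[k'] TPow k' H' n)) =
      (TensorProduct.assoc k' H' (TPow k' H' n) H').symm (lTensor H' (cPow D n)
        (TensorProduct.assoc k' H' H' (TPow k' H' n) (D.c (h ⊗ₜ l) ⊗ₜ x))) :=
  rfl

lemma cPow_one (x : TPow k' H' n) : cPow D n (1 ⊗ₜ x) = x ⊗ₜ 1 := by
  induction n with
  | zero => exact D.c_one_left x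
  | succ n ih =>
    have h : cPow D (n + 1) ∘ₗ TensorProduct.mk k' H' (H' ⊗[k'] TPow k' H' n) 1 =
        (TensorProduct.mk k' (H' ⊗[k'] TPow k' H' n) H').flip 1 :=
      TensorProduct.ext' fun h x => by
        refine (cPow_succ_tmul D n 1 h x).trans ?_
        rw [D.c_one_left]
        exact congr((TensorProduct.assoc k' H' (TPow k' H' n) H').symm (h ⊗ₜ $(ih x)))
    exact LinearMap.congr_fun h x

lemma cPow_succ_one (h : H') (x : TPow k' H' n) : cPow D (n + 1) (h ⊗ₜ oneTmul k' H' n x) =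
    rTensor H' (oneTmul k' H' n) (cPow D n (h ⊗ₜ x)) := by
  refine (cPow_succ_tmul D n h 1 x).trans ?_
  rw [D.c_one_right]
  have key : (TensorProduct.assoc k' H' (TPow k' H' n) H').symm.toLinearMap ∘ₗ
      TensorProduct.mk k' H' (TPow k' H' n ⊗[k'] H') 1 =
        rTensor H' (TensorProduct.mk k' H' (TPow k' H' n) 1) :=
    TensorProduct.ext' fun _ _ => rfl
  exact LinearMap.congr_fun key (cPow D n (h ⊗ₜ x))

lemma sPow_succ_one (x : TPow k' H' n) (a : A') : sPow D (n + 1) (oneTmul k' H' n x ⊗ₜ a) =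
    lTensor A' (oneTmul k' H' n) (sPow D n (x ⊗ₜ a)) := by
  have key : (TensorProduct.assoc k' A' H' (TPow k' H' n)).toLinearMap
      ∘ₗ rTensor (TPow k' H' n) D.s
      ∘ₗ (TensorProduct.assoc k' H' A' (TPow k' H' n)).symm.toLinearMap
      ∘ₗ TensorProduct.mk k' H' (A' ⊗[k'] TPow k' H' n) 1 =
        lTensor A' (TensorProduct.mk k' H' (TPow k' H' n) 1) :=
    TensorProduct.ext' fun a x =>
      congr(TensorProduct.assoc k' A' H' (TPow k' H' n) ($(D.s_one_left a) ⊗ₜ x))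
  exact LinearMap.congr_fun key (sPow D n (x ⊗ₜ a))

lemma comulPow_succ_one (x : TPow k' H' n) : comulPow D (n + 1) (oneTmul k' H' n x) =
    TensorProduct.map (oneTmul k' H' n) (oneTmul k' H' n) (comulPow D n x) := by
  have key : (TensorProduct.assoc k' H' (TPow k' H' n) (H' ⊗[k'] TPow k' H' n)).symm.toLinearMap
      ∘ₗ lTensor H' ((TensorProduct.assoc k' (TPow k' H' n) H' (TPow k' H' n)).toLinearMap
          ∘ₗ rTensor (TPow k' H' n) (cPow D n)
          ∘ₗ (TensorProduct.assoc k' H' (TPow k' H' n) (TPow k' H' n)).symm.toLinearMap)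
      ∘ₗ (TensorProduct.assoc k' H' H' (TPow k' H' n ⊗[k'] TPow k' H' n)).toLinearMap
      ∘ₗ TensorProduct.mk k' (H' ⊗[k'] H') (TPow k' H' n ⊗[k'] TPow k' H' n) (1 ⊗ₜ 1) =
        TensorProduct.map (TensorProduct.mk k' H' (TPow k' H' n) 1)
          (TensorProduct.mk k' H' (TPow k' H' n) 1) :=
    TensorProduct.ext' fun x y =>
      congr((TensorProduct.assoc k' H' (TPow k' H' n) (H' ⊗[k'] TPow k' H' n)).symm
        ((1 : H') ⊗ₜ[k'] TensorProduct.assoc k' (TPow k' H' n) H' (TPow k' H' n)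
          ($(cPow_one D n x) ⊗ₜ[k'] y)))
  refine .trans ?_ (LinearMap.congr_fun key (comulPow D n x))
  rw [← D.comul_one]
  rfl

lemma counitPow_succ_one (D : ModAlgData k' H' A') (n : ℕ) (x : TPow k' H' n) :
    counitPow k' H' (n + 1) (oneTmul k' H' n x) = counitPow k' H' n x := by
  change Coalgebra.counit (R := k') (1 : H') * counitPow k' H' n x = _
  rw [D.counit_one, one_mul]

variable {D n}

lemma iotaPow_convPow (f g : TPow k' H' (n + 1) →ₗ[k'] A') :
    iotaPow n (convPow D (n + 1) f g) = convPow D n (iotaPow n f) (iotaPow n g) := by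
  ext x
  change convPow D (n + 1) f g (oneTmul k' H' n x) =
    convPow D n (f ∘ₗ oneTmul k' H' n) (g ∘ₗ oneTmul k' H' n) x
  rw [convPow, convPow, TensorProduct.map_comp]
  simp only [LinearMap.comp_apply, comulPow_succ_one]

lemma iotaPow_unitPow (D : ModAlgData k' H' A') :
    iotaPow n (unitPow k' H' A' (n + 1)) = unitPow k' H' A' n := by
  ext x
  change unitPow k' H' A' (n + 1) (oneTmul k' H' n x) = _
  rw [unitPow, unitPow]
  simp only [LinearMap.comp_apply, counitPow_succ_one D n]

lemma iotaPow_compatPow {f : TPow k' H' (n + 1) →ₗ[k'] A'} (hf : CompatPow D (n + 1) f) :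
    CompatPow D n (iotaPow n f) := by
  refine TensorProduct.ext' fun h x => ?_
  have := LinearMap.congr_fun hf (h ⊗ₜ oneTmul k' H' n x)
  rw [LinearMap.comp_apply, LinearMap.comp_apply, cPow_succ_one] at this
  change _ = (rTensor H' (f ∘ₗ oneTmul k' H' n) ∘ₗ _) _
  rw [rTensor_comp]
  exact this

lemma iotaPow_centralPow {f : TPow k' H' (n + 1) →ₗ[k'] A'} (hf : CentralPow D (n + 1) f) :
    CentralPow D n (iotaPow n f) := by
  refine TensorProduct.ext' fun x a => ?_
  have := LinearMap.congr_fun hf (oneTmul k' H' n x ⊗ₜ a)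
  rw [LinearMap.comp_apply, LinearMap.comp_apply, sPow_succ_one] at this
  change (_ ∘ₗ lTensor A' (f ∘ₗ oneTmul k' H' n) ∘ₗ _) _ = _
  rw [lTensor_comp]
  exact this

lemma iotaPow_mem_regS {f : TPow k' H' (n + 1) →ₗ[k'] A'} (hf : f ∈ RegS D (n + 1)) :
    iotaPow n f ∈ RegS D n := by
  obtain ⟨h₁, h₂, g, hfg, hgf⟩ := hf
  refine ⟨iotaPow_compatPow h₁, iotaPow_centralPow h₂, iotaPow n g, ?_, ?_⟩
  · rw [← iotaPow_convPow, hfg, iotaPow_unitPow D]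
  · rw [← iotaPow_convPow, hgf, iotaPow_unitPow D]

/-- The `H`-linear extension of a map on `H^{⊗(n+1)}` to `H^{⊗(n+2)}`. -/
def extendPow (D : ModAlgData k' H' A') (g : TPow k' H' n →ₗ[k'] A') :
    TPow k' H' (n + 1) →ₗ[k'] A' :=
  D.ρ ∘ₗ lTensor H' g

lemma iotaPow_extendPow (g : TPow k' H' n →ₗ[k'] A') : iotaPow n (extendPow D g) = g := by
  ext x
  exact D.ρ_one (g x)

lemma extendPow_iotaPow {f : TPow k' H' (n + 1) →ₗ[k'] A'} (hf : HLinearPow D (n + 1) f) :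
    extendPow D (iotaPow n f) = f :=
  TensorProduct.ext' fun h x =>
    (LinearMap.congr_fun hf (h ⊗ₜ oneTmul k' H' n x)).symm.trans
      congr(f (($(mul_one h) : H') ⊗ₜ[k'] x))

lemma hLinearPow_extendPow (g : TPow k' H' n →ₗ[k'] A') :
    HLinearPow D (n + 1) (extendPow D g) := by
  have h : (D.ρ ∘ₗ rTensor A' (LinearMap.mul' k' H')) ∘ₗ
      (TensorProduct.assoc k' H' H' A').symm.toLinearMap = D.ρ ∘ₗ lTensor H' D.ρ := by
    rw [D.ρ_mul]
    exact TensorProduct.ext <| LinearMap.ext fun h => TensorProduct.ext' fun l a => rfl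
  exact TensorProduct.ext <| LinearMap.ext fun m => TensorProduct.ext' fun l x =>
    LinearMap.congr_fun h (m ⊗ₜ (l ⊗ₜ g x))

lemma extendPow_mem_regS (hcc : D.Cocomm) {g : TPow k' H' n →ₗ[k'] A'} (hg : g ∈ RegS D n) :
    extendPow D g ∈ RegS D (n + 1) := by
  obtain ⟨h₁, h₂, g', hgg', hg'g⟩ := hg
  let B := D.toBraidedAction hcc
  have G := D.isPower hcc n
  have hg : ModuleCat.of k' H' ◁ ModuleCat.ofHom g ≫ B.s =
      ModuleCat.ofHom (cPow D n) ≫ ModuleCat.ofHom g ▷ ModuleCat.of k' H' :=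
    ModuleCat.hom_ext h₁
  have hg' : CompatPow D n g' :=
    congr(($(G.compat_inv (g' := ModuleCat.ofHom g') hg (ModuleCat.hom_ext hgg')
      (ModuleCat.hom_ext hg'g))).hom)
  have unit : extendPow D (unitPow k' H' A' n) = unitPow k' H' A' (n + 1) :=
    congr(($(B.unit_ext (uT := ModuleCat.ofHom (counitPow k' H' n)))).hom)
  have mul (f f' : TPow k' H' n →ₗ[k'] A') (hf : CompatPow D n f) :
      convPow D (n + 1) (extendPow D f) (extendPow D f') = extendPow D (convPow D n f f') :=
    congr(($(B.mul_ext (g := ModuleCat.ofHom f) (g' := ModuleCat.ofHom f')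
      (cT := ModuleCat.ofHom (cPow D n)) (dT := ModuleCat.ofHom (comulPow D n))
      (ModuleCat.hom_ext hf))).hom)
  refine ⟨congr(($(B.compat_ext hg)).hom),
    congr(($(G.central_ext hg (ModuleCat.hom_ext h₂))).hom), extendPow D g', ?_, ?_⟩
  · rw [mul _ _ h₁, hgg', unit]
  · rw [mul _ _ hg', hg'g, unit]

end Instantiation

/-- Lemma 2.1: for a cocommutative braided Hopf algebra `H` and a left
`H`-module algebra `(A, s)`, the map `ι_n : f ↦ f(1⊗–)` restricts to a bijection from
`Reg^s_H(H^{n+2}, A)` onto `Reg^s(H^{n+1}, A)` and transforms convolution into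
convolution; hence it is an isomorphism of abelian groups. (Here the tensor power
`TPow k H m` denotes `H^{⊗(m+1)}`, so `n ≥ 1` in the paper corresponds to `n : ℕ` here.) -/
theorem iota_bijection_Reg (D : ModAlgData k' H' A') (hcc : D.Cocomm) (n : ℕ) :
    Set.BijOn (iotaPow n) (RegSH D (n + 1)) (RegS D n) ∧
    ∀ f g, f ∈ RegSH D (n + 1) → g ∈ RegSH D (n + 1) →
      iotaPow n (convPow D (n + 1) f g) = convPow D n (iotaPow n f) (iotaPow n g) := by
  refine ⟨⟨fun f hf => iotaPow_mem_regS hf.1, fun f hf g hg h => ?_, fun g hg =>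
    ⟨extendPow D g, ⟨extendPow_mem_regS hcc hg, hLinearPow_extendPow g⟩,
      iotaPow_extendPow g⟩⟩, fun f g _ _ => iotaPow_convPow f g⟩
  rw [← extendPow_iotaPow hf.2, h, extendPow_iotaPow hg.2]
end
end

section
/- Let k be a field and Q an invertible 2×2 matrix over k. Define k-linear maps α_i^j : k[X] → k[X] (i, j ∈ {1,2}) by α_i^j(Xⁿ) = (Qⁿ)_{ij} Xⁿ for all n ≥ 0. Suppose β₁, β₂ : k[X] → k[X] are k-linear maps satisfying the twisted Leibniz rule β_i(fg) = β_i(f)·g + Σ_{j=1}^{2} α_i^j(f)·β_j(g) for all f, g ∈ k[X] and i ∈ {1,2}. Then β_i(1) = 0 for i = 1,2, and for every n ≥ 1 and i ∈ {1,2}: β_i(Xⁿ) = Σ_{j=1}^{2} (Σ_{m=0}^{n-1} Qᵐ)_{ij} · X^{n-1} · β_j(X). -/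
open Polynomial

/-- For an invertible 2×2 matrix `Q` over a field `k`, linear maps
`α i j` on `k[X]` with `α i j (Xⁿ) = (Qⁿ)_{ij} Xⁿ`, and linear maps `β₁ β₂` satisfying the
twisted Leibniz rule, one has `β i 1 = 0` and the displayed formula for `β i (Xⁿ)`. -/
theorem braided_polynomial_twisted_derivations
    (k : Type*) [Field k] (Q : Matrix (Fin 2) (Fin 2) k) (hQ : IsUnit Q)
    (α : Fin 2 → Fin 2 → (Polynomial k →ₗ[k] Polynomial k))
    (hα : ∀ i j (n : ℕ), α i j (X ^ n) = (Q ^ n) i j • X ^ n)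
    (β : Fin 2 → (Polynomial k →ₗ[k] Polynomial k))
    (hβ : ∀ i (f g : Polynomial k), β i (f * g) = β i f * g + ∑ j, α i j f * β j g) :
    (∀ i, β i 1 = 0) ∧
      ∀ n : ℕ, 1 ≤ n → ∀ i,
        β i (X ^ n) = ∑ j, (∑ m ∈ Finset.range n, Q ^ m) i j • (X ^ (n - 1) * β j X) := by
  refine ⟨fun i => ?_, fun n hn => ?_⟩
  · have h := hβ i 1 1
    have hα₁ : ∀ j, α i j 1 = (1 : Matrix (Fin 2) (Fin 2) k) i j • 1 := fun j => by
      simpa using hα i j 0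
    simpa [hα₁, Matrix.one_apply] using h
  · induction n, hn using Nat.le_induction with
    | base => intro i; simp [Matrix.one_apply]
    | succ n hn ih =>
      intro i
      obtain ⟨m, rfl⟩ := Nat.exists_eq_add_of_le' hn
      rw [pow_succ, hβ, ih, Finset.sum_mul, ← Finset.sum_add_distrib]
      refine Finset.sum_congr rfl fun j _ => ?_
      rw [hα, Finset.sum_range_succ _ (m + 1), Matrix.add_apply, add_smul]
      simp only [Nat.add_sub_cancel, smul_mul_assoc, pow_succ X m]
      ring_nf
end
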